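/- Let (R,m) be a commutative Noetherian local ring which is equidimensional (dim(R/p) = dim(R) for every minimal prime p of R) and such that, for every minimal prime p of R, both R_p and every localization at a prime ideal of the fiber ring κ(p) ⊗_R R̂ are Gorenstein local rings, where R̂ denotes the m-adic completion of R and κ(p) = R_p/pR_p. Let y_1,...,y_q ∈ m be an R-regular sequence, set R' = R/(y_1,...,y_q), and let C be a semidualizing R-module. Then for every ideal J of R' primary to the maximal ideal of R', the Hilbert–Samuel multiplicities satisfy e(J, C ⊗_R R') = e(J, R'). -/

import Mathlib

open CategoryTheory

/-- The `i`-th Ext module of two `R`-modules, over a commutative ring `R`. -/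
noncomputable def ExtModule (R : Type) [CommRing R] (M N : ModuleCat.{0} R) (i : ℕ) :
    ModuleCat R :=
  ((Ext R (ModuleCat.{0} R) i).obj (Opposite.op M)).obj N

/-- `C` is a semidualizing `R`-module: it is finitely generated, the homothety map
`R → Hom_R(C,C)` is bijective, and `Ext^i_R(C,C) = 0` for all `i > 0`. -/
def IsSemidualizing (R : Type) [CommRing R] (C : Type) [AddCommGroup C] [Module R C] : Prop :=
  Module.Finite R C ∧
  Function.Bijective (algebraMap R (Module.End R C)) ∧
  ∀ i : ℕ, 0 < i → Subsingleton (ExtModule R (ModuleCat.of R C) (ModuleCat.of R C) i)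

/-- `M` has finite injective dimension over `R`: `Ext^i_R(-, M)` vanishes uniformly
for all large `i`. -/
def HasFiniteInjectiveDimension (R : Type) [CommRing R] (M : Type) [AddCommGroup M]
    [Module R M] : Prop :=
  ∃ n : ℕ, ∀ (N : ModuleCat.{0} R) (i : ℕ), n < i →
    Subsingleton (ExtModule R N (ModuleCat.of R M) i)

/-- A Gorenstein local ring: a commutative Noetherian local ring having finite injective
dimension as a module over itself. -/
def IsGorensteinLocalRing (R : Type) [CommRing R] : Prop :=
  IsNoetherianRing R ∧ IsLocalRing R ∧ HasFiniteInjectiveDimension R R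

/-- The length of an `R`-module, i.e. the Krull dimension of its lattice of submodules. -/
noncomputable def moduleLength (R M : Type) [CommRing R] [AddCommGroup M] [Module R M] :
    WithBot ℕ∞ :=
  Order.krullDim (Submodule R M)

open Polynomial in
theorem exists_polynomial_diff_eq (p : ℚ[X]) :
    ∃ q : ℚ[X], ∀ x : ℚ, q.eval (x + 1) - q.eval x = p.eval x := by
  induction p using Polynomial.induction_on' with
  | add p q hp hq =>
    obtain ⟨p', hp'⟩ := hp
    obtain ⟨q', hq'⟩ := hq
    refine ⟨p' + q', fun x => ?_⟩
    simp only [eval_add, ← hp', ← hq']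
    ring
  | monomial k a =>
    refine ⟨C (a / (k + 1)) * Polynomial.bernoulli (k + 1), fun x => ?_⟩
    have h1 : (k : ℚ) + 1 ≠ 0 := by positivity
    simp only [eval_mul, eval_C, eval_monomial, add_comm x 1,
      Polynomial.bernoulli_eval_one_add]
    push_cast
    field_simp
    rw [add_sub_cancel_left]
    ring

open Polynomial in
theorem exists_polynomial_eventually_of_diff {f : ℕ → ℚ} {p : ℚ[X]}
    (h : ∀ᶠ n : ℕ in Filter.atTop, f (n + 1) - f n = p.eval (n : ℚ)) :
    ∃ q : ℚ[X], ∀ᶠ n : ℕ in Filter.atTop, f n = q.eval (n : ℚ) := by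
  obtain ⟨q, hq⟩ := exists_polynomial_diff_eq p
  obtain ⟨N, hN⟩ := Filter.eventually_atTop.1 h
  refine ⟨q + C (f N - q.eval (N : ℚ)), Filter.eventually_atTop.2 ⟨N, fun n hn => ?_⟩⟩
  induction n, hn using Nat.le_induction with
  | base => simp
  | succ n hn ih =>
    have := hN n hn
    have h2 := hq n
    simp only [eval_add, eval_C] at ih ⊢
    push_cast
    linarith

section HilbertPolynomial

variable {R N : Type*} [CommRing R] [AddCommGroup N] [Module R N]

theorem length_quotient_eq_add {G : Type*} [AddCommGroup G] [Module R G] (F F' : Submodule R N)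
    (φ : G →ₗ[R] N ⧸ F) (hle : F ≤ F') (hF : LinearMap.range φ = F'.map F.mkQ) :
    Module.length R (N ⧸ F) = Module.length R (G ⧸ LinearMap.ker φ) + Module.length R (N ⧸ F') := by
  rw [φ.quotKerEquivRange.length_eq]
  refine Module.length_eq_add_of_exact (LinearMap.range φ).subtype (Submodule.factor hle)
    (Submodule.injective_subtype _) (Submodule.factor_surjective hle) ?_
  rw [LinearMap.exact_iff, Submodule.range_subtype, hF]
  ext y
  obtain ⟨y, rfl⟩ := F.mkQ_surjective y
  rw [LinearMap.mem_ker, Submodule.factor_mk, Submodule.mkQ_apply,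
    Submodule.Quotient.mk_eq_zero, Submodule.mem_map]
  constructor
  · exact fun hy => ⟨y, hy, rfl⟩
  · rintro ⟨z, hz, hzy⟩
    have := hle ((Submodule.Quotient.eq F).1 hzy)
    simpa using F'.sub_mem hz this

theorem length_quotient_inf_comap_add (F G : Submodule R N) (x : N →ₗ[R] N) :
    Module.length R (N ⧸ (G ⊓ F.comap x)) + Module.length R (N ⧸ (F ⊔ G.map x)) =
      Module.length R (N ⧸ G) + Module.length R (N ⧸ F) := by
  rw [length_quotient_eq_add F (F ⊔ G.map x) (F.mkQ ∘ₗ x ∘ₗ G.subtype) le_sup_left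
    (by rw [LinearMap.range_comp, LinearMap.range_comp]; simp [Submodule.map_sup]),
    length_quotient_eq_add (G ⊓ F.comap x) G ((G ⊓ F.comap x).mkQ ∘ₗ G.subtype) inf_le_left
    (by rw [LinearMap.range_comp]; simp)]
  have : LinearMap.ker (F.mkQ ∘ₗ x ∘ₗ G.subtype) =
      LinearMap.ker ((G ⊓ F.comap x).mkQ ∘ₗ G.subtype) := by
    ext y
    simp
  rw [this]
  ring

/-- Hilbert's theorem for subquotients `G n / F n` of a fixed module, acted on in degree one by
multiplication by the elements of `as`. -/
theorem exists_polynomial_eventually_eq_length_sub (as : List R) :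
    ∀ F G : ℕ → Submodule R N, (∀ n, F n ≤ G n) →
      (∀ n, Module.length R (N ⧸ F n) ≠ ⊤) →
      (∀ a ∈ as, ∀ n, (F n).map (LinearMap.lsmul R N a) ≤ F (n + 1)) →
      (∀ a ∈ as, ∀ n, (G n).map (LinearMap.lsmul R N a) ≤ G (n + 1)) →
      (∀ H : ℕ → Submodule R N, (∀ n, F n ≤ H n) → (∀ n, H n ≤ G n) →
        (∀ a ∈ as, ∀ n, (H n).map (LinearMap.lsmul R N a) ≤ H (n + 1)) →
        ∃ n₀, ∀ n ≥ n₀, H (n + 1) ≤ F (n + 1) ⊔ Ideal.span {a | a ∈ as} • H n) →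
      ∃ q : Polynomial ℚ, ∀ᶠ n : ℕ in Filter.atTop,
        ((Module.length R (N ⧸ F n)).toNat : ℚ) - ((Module.length R (N ⧸ G n)).toNat : ℚ) =
          q.eval (n : ℚ) := by
  have fin {A B : Submodule R N} (h : A ≤ B) (hA : Module.length R (N ⧸ A) ≠ ⊤) :
      Module.length R (N ⧸ B) ≠ ⊤ :=
    ne_top_of_le_ne_top hA (Module.length_le_of_surjective _ (Submodule.factor_surjective h))
  induction as with
  | nil =>
    intro F G hFG _ _ _ hfg
    obtain ⟨n₀, hn₀⟩ := hfg G hFG (fun _ => le_rfl) (by simp)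
    refine ⟨0, Filter.eventually_atTop.2 ⟨n₀ + 1, fun n hn => ?_⟩⟩
    obtain ⟨n, rfl⟩ := Nat.exists_eq_succ_of_ne_zero (by lia : n ≠ 0)
    have := hn₀ n (by lia)
    simp only [List.not_mem_nil, Set.ofPred_false, Submodule.span_empty, Submodule.bot_smul,
      sup_bot_eq] at this
    rw [Nat.succ_eq_add_one, le_antisymm this (hFG _), sub_self, Polynomial.eval_zero]
  | cons x as ih =>
    intro F G hFG hlen hF hG hfg
    set X := LinearMap.lsmul R N x with hX
    have hcomm (a : R) (H : Submodule R N) :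
        (H.map X).map (LinearMap.lsmul R N a) = (H.map (LinearMap.lsmul R N a)).map X := by
      rw [← Submodule.map_comp, ← Submodule.map_comp]
      congr 1
      ext m
      exact smul_comm a x m
    have hspan (H : Submodule R N) : Ideal.span {a | a ∈ x :: as} • H =
        H.map X ⊔ Ideal.span {a | a ∈ as} • H := by
      have : {a | a ∈ x :: as} = insert x {a | a ∈ as} := by ext; simp
      rw [this, Ideal.span_insert, Submodule.sup_smul, Submodule.ideal_span_singleton_smul]
      rfl
    obtain ⟨p, hp⟩ := ih F (fun n => G n ⊓ (F (n + 1)).comap X)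
      (fun n => le_inf (hFG n) (Submodule.map_le_iff_le_comap.1 (hF x (by simp) n))) hlen
      (fun a ha => hF a (by simp [ha])) (fun a ha n => by
        refine le_inf ((Submodule.map_mono inf_le_left).trans (hG a (by simp [ha]) n)) ?_
        rw [← Submodule.map_le_iff_le_comap, ← hcomm]
        refine (Submodule.map_mono ?_).trans (hF a (by simp [ha]) (n + 1))
        exact Submodule.map_le_iff_le_comap.2 inf_le_right)
      (fun H h1 h2 h3 => by
        have hxH (n : ℕ) : (H n).map X ≤ F (n + 1) :=
          Submodule.map_le_iff_le_comap.2 ((h2 n).trans inf_le_right)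
        obtain ⟨n₀, hn₀⟩ := hfg H h1 (fun n => (h2 n).trans inf_le_left) (fun a ha n => by
          rcases List.mem_cons.1 ha with rfl | ha
          · exact (hxH n).trans (h1 _)
          · exact h3 a ha n)
        refine ⟨n₀, fun n hn => (hn₀ n hn).trans ?_⟩
        rw [hspan, ← sup_assoc]
        exact sup_le_sup_right (sup_le le_rfl (hxH n)) _)
    obtain ⟨q, hq⟩ := ih (fun n => F (n + 1) ⊔ (G n).map X) (fun n => G (n + 1))
      (fun n => sup_le (hFG _) (hG x (by simp) n)) (fun n => fin le_sup_left (hlen _))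
      (fun a ha n => by
        rw [Submodule.map_sup, hcomm]
        exact sup_le_sup (hF a (by simp [ha]) _) (Submodule.map_mono (hG a (by simp [ha]) _)))
      (fun a ha n => hG a (by simp [ha]) _)
      (fun H h1 h2 h3 => by
        obtain ⟨n₀, hn₀⟩ := hfg (fun n => n.casesOn (F 0) H) (fun n => by
            cases n with
            | zero => exact le_rfl
            | succ n => exact le_sup_left.trans (h1 n)) (fun n => by
            cases n with
            | zero => exact hFG 0
            | succ n => exact h2 n) (fun a ha n => by
            cases n with
            | zero => exact (hF a ha 0).trans (le_sup_left.trans (h1 0))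
            | succ n =>
              rcases List.mem_cons.1 ha with rfl | ha
              · exact (Submodule.map_mono (h2 n)).trans (le_sup_right.trans (h1 (n + 1)))
              · exact h3 a ha n)
        refine ⟨n₀, fun n hn => (hn₀ (n + 1) (by lia)).trans ?_⟩
        change F (n + 2) ⊔ _ • H n ≤ _
        rw [hspan, ← sup_assoc]
        refine sup_le_sup_right (sup_le_sup_left (Submodule.map_mono (h2 n)) _) _)
    refine exists_polynomial_eventually_of_diff (p := q - p) ?_
    filter_upwards [hp, hq] with n hpn hqn
    have key := length_quotient_inf_comap_add (F (n + 1)) (G n) X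
    have e1 := fin (le_inf (hFG n) (Submodule.map_le_iff_le_comap.1 (hF x (by simp) n))) (hlen n)
    have e2 := fin (le_sup_left : _ ≤ F (n + 1) ⊔ (G n).map X) (hlen _)
    have key' := congrArg ENat.toNat key
    rw [ENat.toNat_add e1 e2, ENat.toNat_add (fin (hFG n) (hlen n)) (hlen _)] at key'
    have key'' := congrArg (Nat.cast (R := ℚ)) key'
    push_cast at key''
    rw [Polynomial.eval_sub, ← hpn, ← hqn]
    linarith

end HilbertPolynomial

section PolynomialGrowth

open Polynomial Filter

theorem Polynomial.eventually_natCast {P : ℚ → Prop} (h : ∀ᶠ x in atTop, P x) :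
    ∀ᶠ n : ℕ in atTop, P n :=
  tendsto_natCast_atTop_atTop.eventually h

theorem Polynomial.eventually_eval_ne_zero {p : ℚ[X]} (hp : p ≠ 0) :
    ∀ᶠ n : ℕ in atTop, p.eval (n : ℚ) ≠ 0 :=
  Polynomial.eventually_natCast (p.eventually_atTop_not_isRoot hp)

theorem Polynomial.degree_le_of_eventually_le {p q : ℚ[X]}
    (h0 : ∀ᶠ n : ℕ in atTop, 0 ≤ p.eval (n : ℚ))
    (h : ∀ᶠ n : ℕ in atTop, p.eval (n : ℚ) ≤ q.eval (n : ℚ)) : p.degree ≤ q.degree := by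
  by_contra! hlt
  have hp : p ≠ 0 := by
    rintro rfl
    simp at hlt
  have ht := (div_tendsto_atTop_zero_of_degree_lt q p hlt).comp
    (tendsto_natCast_atTop_atTop (R := ℚ))
  have hlt1 := ht.eventually_lt_const (one_pos)
  obtain ⟨n, h1, h2, h3, h4⟩ := (h0.and (h.and (hlt1.and (eventually_eval_ne_zero hp)))).exists
  have hpos := lt_of_le_of_ne h1 (Ne.symm h4)
  simp only [Function.comp_apply] at h3
  rw [div_lt_one hpos] at h3
  linarith

theorem Polynomial.degree_sub_taylor_lt {p : ℚ[X]} {d : ℕ} (hp : p.degree ≤ d) (r : ℚ) :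
    (p - taylor r p).degree < d := by
  by_cases h : p = 0
  · simp [h]
  · exact (degree_sub_lt_left (degree_taylor p r).symm h (leadingCoeff_taylor r p).symm).trans_le hp

theorem Polynomial.degree_le_of_taylor_sub {p : ℚ[X]} {d : ℕ}
    (h : (taylor 1 p - p).degree ≤ d) : p.degree ≤ (d + 1 : ℕ) := by
  by_contra! hlt
  have hdeg : d + 1 < p.natDegree :=
    not_le.1 fun hle => hlt.not_ge (natDegree_le_iff_degree_le.1 hle)
  have hfun : fwdDiff 1 p.eval = (taylor 1 p - p).eval := by
    ext x
    simp [fwdDiff, taylor_eval]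
  obtain ⟨k, hk⟩ := Nat.exists_eq_succ_of_ne_zero (by lia : p.natDegree ≠ 0)
  have h1 := p.fwdDiff_iter_degree_eq_factorial
  rw [hk, Function.iterate_succ_apply, hfun, fwdDiff_iter_eq_zero_of_degree_lt
    ((natDegree_le_iff_degree_le.2 h).trans_lt (by lia))] at h1
  have h2 := congrFun h1 0
  have hp : p ≠ 0 := by
    rintro rfl
    simp at hdeg
  simp [hp, Nat.factorial_ne_zero] at h2

end PolynomialGrowth

universe u

section Devissage

variable {R : Type u} [CommRing R]

theorem Module.mem_support_quotient_iff {I : Ideal R} {p : PrimeSpectrum R} :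
    p ∈ Module.support R (R ⧸ I) ↔ I ≤ p.asIdeal := by
  rw [Module.mem_support_iff_of_finite, Ideal.annihilator_quotient]

theorem induction_on_quotient_prime_of_support_subset [IsNoetherianRing R]
    (Z : Set (PrimeSpectrum R))
    {motive : (N : Type u) → [AddCommGroup N] → [Module R N] → [Module.Finite R N] → Prop}
    (subsingleton : (N : Type u) → [AddCommGroup N] → [Module R N] → [Module.Finite R N] →
      [Subsingleton N] → motive N)
    (quotient : ∀ p ∈ Z, motive (R ⧸ p.asIdeal))
    (exact : (N₁ : Type u) → [AddCommGroup N₁] → [Module R N₁] → [Module.Finite R N₁] →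
      (N₂ : Type u) → [AddCommGroup N₂] → [Module R N₂] → [Module.Finite R N₂] →
      (N₃ : Type u) → [AddCommGroup N₃] → [Module R N₃] → [Module.Finite R N₃] →
      (f : N₁ →ₗ[R] N₂) → (g : N₂ →ₗ[R] N₃) → Module.support R N₂ ⊆ Z →
      Function.Injective f → Function.Surjective g → Function.Exact f g →
      motive N₁ → motive N₃ → motive N₂)
    (M : Type u) [AddCommGroup M] [Module R M] [Module.Finite R M]
    (hM : Module.support R M ⊆ Z) : motive M := by
  induction ‹Module.Finite R M› using
    IsNoetherianRing.induction_on_isQuotientEquivQuotientPrime R with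
  | subsingleton N => exact subsingleton N
  | quotient N p e =>
    have hp : p ∈ Z := hM (e.support_eq ▸ Module.mem_support_quotient_iff.2 le_rfl)
    exact exact (R ⧸ p.asIdeal) N PUnit.{u + 1} e.symm.toLinearMap 0 hM e.symm.injective
      (Function.surjective_to_subsingleton _)
      ((e.symm.toLinearMap.exact_zero_iff_surjective _).2 e.symm.surjective)
      (quotient p hp) (subsingleton _)
  | exact N₁ N₂ N₃ f g hf hg hfg h₁ h₃ =>
    exact exact N₁ N₂ N₃ f g hM hf hg hfg
      (h₁ ((Module.support_subset_of_injective f hf).trans hM))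
      (h₃ ((Module.support_subset_of_surjective g hg).trans hM))

/-- `F` is additive on short exact sequences of finitely generated modules supported in `Z`. -/
def AdditiveOn {G : Type*} [AddCommGroup G] (Z : Set (PrimeSpectrum R))
    (F : (M : Type u) → [AddCommGroup M] → [Module R M] → G) : Prop :=
  ∀ (N₁ : Type u) [AddCommGroup N₁] [Module R N₁] [Module.Finite R N₁]
    (N₂ : Type u) [AddCommGroup N₂] [Module R N₂] [Module.Finite R N₂]
    (N₃ : Type u) [AddCommGroup N₃] [Module R N₃] [Module.Finite R N₃]
    (f : N₁ →ₗ[R] N₂) (g : N₂ →ₗ[R] N₃), Module.support R N₂ ⊆ Z →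
    Function.Injective f → Function.Surjective g → Function.Exact f g →
    F N₂ = F N₁ + F N₃

namespace AdditiveOn

variable {G : Type*} [AddCommGroup G] {Z : Set (PrimeSpectrum R)}
  {F : (M : Type u) → [AddCommGroup M] → [Module R M] → G}

theorem eq_zero_of_subsingleton (hF : AdditiveOn Z F) (M : Type u) [AddCommGroup M] [Module R M]
    [Subsingleton M] : F M = 0 := by
  have h := hF M M M 0 0 (by simp [Module.support_eq_empty])
    (Function.injective_of_subsingleton _) (Function.surjective_to_subsingleton _)
    (fun x => by simp [Subsingleton.elim x 0])
  simpa using h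

theorem eq_of_linearEquiv (hF : AdditiveOn Z F) {M N : Type u} [AddCommGroup M] [Module R M]
    [Module.Finite R M] [AddCommGroup N] [Module R N] (hM : Module.support R M ⊆ Z)
    (e : M ≃ₗ[R] N) : F M = F N := by
  have := Module.Finite.equiv e
  have h := hF M N PUnit.{u + 1} e.toLinearMap 0 (e.support_eq ▸ hM) e.injective
    (Function.surjective_to_subsingleton _)
    ((e.toLinearMap.exact_zero_iff_surjective _).2 e.surjective)
  rw [h, hF.eq_zero_of_subsingleton PUnit, add_zero]

variable [IsNoetherianRing R]

theorem eq_range_add_range (hF : AdditiveOn Z F) {A B C : Type u} [AddCommGroup A] [Module R A]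
    [AddCommGroup B] [Module R B] [Module.Finite R B] [AddCommGroup C] [Module R C]
    (hB : Module.support R B ⊆ Z) (f : A →ₗ[R] B) (g : B →ₗ[R] C) (h : Function.Exact f g) :
    F B = F (LinearMap.range f) + F (LinearMap.range g) := by
  rw [← LinearMap.exact_iff.1 h]
  exact hF (LinearMap.ker g) B (LinearMap.range g) (LinearMap.ker g).subtype g.rangeRestrict hB
    (Submodule.injective_subtype _) g.surjective_rangeRestrict (fun x => by
      simp [Subtype.ext_iff])

/-- Additivity along a six term exact sequence `0 → A₁ → ⋯ → A₆ → 0`. -/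
theorem six_term (hF : AdditiveOn Z F) {A₁ A₂ A₃ A₄ A₅ A₆ : Type u}
    [AddCommGroup A₁] [Module R A₁] [Module.Finite R A₁]
    [AddCommGroup A₂] [Module R A₂] [Module.Finite R A₂]
    [AddCommGroup A₃] [Module R A₃] [Module.Finite R A₃]
    [AddCommGroup A₄] [Module R A₄] [Module.Finite R A₄]
    [AddCommGroup A₅] [Module R A₅] [Module.Finite R A₅]
    [AddCommGroup A₆] [Module R A₆]
    (h₁ : Module.support R A₁ ⊆ Z) (h₂ : Module.support R A₂ ⊆ Z) (h₃ : Module.support R A₃ ⊆ Z)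
    (h₄ : Module.support R A₄ ⊆ Z) (h₅ : Module.support R A₅ ⊆ Z)
    {f₁ : A₁ →ₗ[R] A₂} {f₂ : A₂ →ₗ[R] A₃} {f₃ : A₃ →ₗ[R] A₄} {f₄ : A₄ →ₗ[R] A₅} {f₅ : A₅ →ₗ[R] A₆}
    (hf₁ : Function.Injective f₁) (h₁₂ : Function.Exact f₁ f₂) (h₂₃ : Function.Exact f₂ f₃)
    (h₃₄ : Function.Exact f₃ f₄) (h₄₅ : Function.Exact f₄ f₅) (hf₅ : Function.Surjective f₅) :
    F A₁ + F A₃ + F A₅ = F A₂ + F A₄ + F A₆ := by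
  have hA₆ : F (LinearMap.range f₅) = F A₆ :=
    hF.eq_of_linearEquiv ((Module.support_subset_of_surjective f₅.rangeRestrict
      f₅.surjective_rangeRestrict).trans h₅) (LinearEquiv.ofTop _ (LinearMap.range_eq_top.2 hf₅))
  rw [hF.eq_of_linearEquiv h₁ (LinearEquiv.ofInjective f₁ hf₁),
    hF.eq_range_add_range h₂ f₁ f₂ h₁₂, hF.eq_range_add_range h₃ f₂ f₃ h₂₃,
    hF.eq_range_add_range h₄ f₃ f₄ h₃₄, hF.eq_range_add_range h₅ f₄ f₅ h₄₅, hA₆]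
  abel

end AdditiveOn

end Devissage

section LocalLength

variable {R : Type u} [CommRing R]

/-- The length of the localization of `M` at the prime `p`. -/
noncomputable def localLength (p : PrimeSpectrum R) (M : Type*) [AddCommGroup M] [Module R M] :
    ℕ∞ :=
  Module.length (Localization.AtPrime p.asIdeal) (LocalizedModule p.asIdeal.primeCompl M)

variable (p : PrimeSpectrum R)

theorem localLength_eq_add_of_exact {M₁ M₂ M₃ : Type*} [AddCommGroup M₁] [Module R M₁]
    [AddCommGroup M₂] [Module R M₂] [AddCommGroup M₃] [Module R M₃]
    (f : M₁ →ₗ[R] M₂) (g : M₂ →ₗ[R] M₃) (hf : Function.Injective f) (hg : Function.Surjective g)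
    (hfg : Function.Exact f g) :
    localLength p M₂ = localLength p M₁ + localLength p M₃ :=
  Module.length_eq_add_of_exact (LocalizedModule.map p.asIdeal.primeCompl f)
    (LocalizedModule.map p.asIdeal.primeCompl g) (LocalizedModule.map_injective _ f hf)
    (LocalizedModule.map_surjective _ g hg) (LocalizedModule.map_exact _ f g hfg)

theorem localLength_eq_zero_iff {M : Type*} [AddCommGroup M] [Module R M] :
    localLength p M = 0 ↔ p ∉ Module.support R M := by
  rw [localLength, Module.length_eq_zero_iff, Module.notMem_support_iff]

theorem localLength_quotient_self : localLength p (R ⧸ p.asIdeal) = 1 := by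
  let A := Localization.AtPrime p.asIdeal
  let L := LocalizedModule p.asIdeal.primeCompl (R ⧸ p.asIdeal)
  have hnt : Nontrivial L := Module.mem_support_quotient_iff.2 le_rfl
  let φ : A →ₗ[A] L := LinearMap.toSpanSingleton A L (LocalizedModule.mk 1 1)
  have hφ_mk (r : R) (s : p.asIdeal.primeCompl) : φ (Localization.mk r s) =
      LocalizedModule.mk (Ideal.Quotient.mk p.asIdeal r) s := by
    refine (LocalizedModule.mk_smul_mk r (1 : R ⧸ p.asIdeal) s 1).trans ?_
    rw [mul_one, ← Algebra.algebraMap_eq_smul_one, Ideal.Quotient.algebraMap_eq]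
  have hφ : Function.Surjective φ := fun x => by
    induction x using LocalizedModule.induction_on with
    | h m s =>
      obtain ⟨r, rfl⟩ := Ideal.Quotient.mk_surjective m
      exact ⟨Localization.mk r s, hφ_mk r s⟩
  have hker : LinearMap.ker φ = IsLocalRing.maximalIdeal A := by
    refine le_antisymm (IsLocalRing.le_maximalIdeal fun h => ?_) fun x hx => ?_
    · rw [LinearMap.ker_eq_top] at h
      exact not_subsingleton L ⟨fun a b => by
        obtain ⟨a, rfl⟩ := hφ a
        obtain ⟨b, rfl⟩ := hφ b
        simp [h]⟩
    · induction x using Localization.induction_on with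
      | H y =>
        obtain ⟨r, s⟩ := y
        have hr : r ∈ p.asIdeal := by
          rw [Localization.mk_eq_mk'] at hx
          exact (IsLocalization.AtPrime.mk'_mem_maximal_iff A p.asIdeal r s).1 hx
        rw [LinearMap.mem_ker, hφ_mk, Ideal.Quotient.eq_zero_iff_mem.2 hr, LocalizedModule.zero_mk]
  change Module.length A L = 1
  rw [← (φ.quotKerEquivOfSurjective hφ).length_eq, hker, Module.length_eq_one_iff,
    isSimpleModule_iff_isCoatom]
  exact (IsLocalRing.maximalIdeal.isMaximal A).out

variable [IsNoetherianRing R]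

theorem localLength_ne_top {M : Type u} [AddCommGroup M] [Module R M] [Module.Finite R M]
    (hM : Module.support R M ⊆ {q | q.asIdeal ≤ p.asIdeal → q = p}) : localLength p M ≠ ⊤ := by
  refine induction_on_quotient_prime_of_support_subset {q | q.asIdeal ≤ p.asIdeal → q = p}
    (motive := fun N _ _ _ => localLength p N ≠ ⊤) (fun N _ _ _ _ => ?_) (fun q hq => ?_)
    (fun N₁ _ _ _ N₂ _ _ _ N₃ _ _ _ f g _ hf hg hfg h₁ h₃ => ?_) M hM
  · rw [(localLength_eq_zero_iff p).2 (by simp [Module.support_eq_empty])]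
    exact ENat.zero_ne_top
  · by_cases h : q.asIdeal ≤ p.asIdeal
    · rw [hq h, localLength_quotient_self]
      exact ENat.one_ne_top
    · rw [(localLength_eq_zero_iff p).2 (by rwa [Module.mem_support_quotient_iff])]
      exact ENat.zero_ne_top
  · rw [localLength_eq_add_of_exact p f g hf hg hfg]
    exact WithTop.add_ne_top.2 ⟨h₁, h₃⟩

theorem additiveOn_localLength (Z : Set (PrimeSpectrum R))
    (hZ : Z ⊆ {q | q.asIdeal ≤ p.asIdeal → q = p}) :
    AdditiveOn Z (fun M _ _ => ((localLength p M).toNat : ℤ)) := by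
  intro N₁ _ _ _ N₂ _ _ _ N₃ _ _ _ f g hZ' hf hg hfg
  have h := hZ'.trans hZ
  beta_reduce
  rw [localLength_eq_add_of_exact p f g hf hg hfg, ENat.toNat_add, Nat.cast_add]
  · exact localLength_ne_top p ((Module.support_subset_of_injective f hf).trans h)
  · exact localLength_ne_top p ((Module.support_subset_of_surjective g hg).trans h)

/-- An additive function that kills `R ⧸ p` for the non-minimal primes `p` over `I` depends only on
the local lengths at the minimal primes of `I`. -/
theorem AdditiveOn.eq_sum_localLength {G : Type*} [AddCommGroup G] {I : Ideal R}
    {F : (M : Type u) → [AddCommGroup M] → [Module R M] → G}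
    (hF : AdditiveOn (PrimeSpectrum.zeroLocus I) F)
    (hF0 : ∀ p : PrimeSpectrum R, I ≤ p.asIdeal → p.asIdeal ∉ I.minimalPrimes →
      F (R ⧸ p.asIdeal) = 0) (s : Finset (PrimeSpectrum R))
    (hs : ∀ p, p ∈ s ↔ p.asIdeal ∈ I.minimalPrimes) {M : Type u} [AddCommGroup M] [Module R M]
    [Module.Finite R M] (hM : Module.support R M ⊆ PrimeSpectrum.zeroLocus I) :
    F M = ∑ p ∈ s, ((localLength p M).toNat : ℤ) • F (R ⧸ p.asIdeal) := by
  classical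
  have hZ : ∀ p ∈ s, (PrimeSpectrum.zeroLocus (I : Set R)) ⊆
      {q : PrimeSpectrum R | q.asIdeal ≤ p.asIdeal → q = p} := fun p hp q hq hqp =>
    PrimeSpectrum.ext (hqp.antisymm (((hs p).1 hp).2 ⟨q.2, hq⟩ hqp))
  refine induction_on_quotient_prime_of_support_subset (PrimeSpectrum.zeroLocus (I : Set R))
    (motive := fun N _ _ _ =>
      F N = ∑ p ∈ s, ((localLength p N).toNat : ℤ) • F (R ⧸ p.asIdeal))
    (fun N _ _ _ _ => ?_) (fun q hq => ?_)
    (fun N₁ _ _ _ N₂ _ _ _ N₃ _ _ _ f g hN₂ hf hg hfg h₁ h₃ => ?_) M hM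
  · rw [hF.eq_zero_of_subsingleton, Finset.sum_eq_zero]
    intro p _
    rw [(localLength_eq_zero_iff p).2 (by simp [Module.support_eq_empty])]
    simp
  · have h0 : ∀ p ∈ s, p ≠ q →
        ((localLength p (R ⧸ q.asIdeal)).toNat : ℤ) • F (R ⧸ p.asIdeal) = 0 := by
      intro p hp hpq
      rw [(localLength_eq_zero_iff p).2]
      · simp
      · rw [Module.mem_support_quotient_iff]
        exact fun h => hpq (hZ p hp hq h).symm
    by_cases hqs : q ∈ s
    · rw [Finset.sum_eq_single_of_mem q hqs h0, localLength_quotient_self]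
      simp
    · rw [hF0 q hq (mt (hs q).2 hqs), Finset.sum_eq_zero]
      exact fun p hp => h0 p hp (fun h => hqs (h ▸ hp))
  · rw [hF N₁ N₂ N₃ f g hN₂ hf hg hfg, h₁, h₃, ← Finset.sum_add_distrib]
    refine Finset.sum_congr rfl fun p hp => ?_
    rw [← add_smul]
    exact congrArg (· • F (R ⧸ p.asIdeal))
      (additiveOn_localLength p _ (hZ p hp) N₁ N₂ N₃ f g hN₂ hf hg hfg).symm

theorem AdditiveOn.eq_of_localLength_eq {G : Type*} [AddCommGroup G] {I : Ideal R}
    {F : (M : Type u) → [AddCommGroup M] → [Module R M] → G}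
    (hF : AdditiveOn (PrimeSpectrum.zeroLocus I) F)
    (hF0 : ∀ p : PrimeSpectrum R, I ≤ p.asIdeal → p.asIdeal ∉ I.minimalPrimes →
      F (R ⧸ p.asIdeal) = 0) {M N : Type u} [AddCommGroup M] [Module R M]
    [Module.Finite R M] [AddCommGroup N] [Module R N] [Module.Finite R N]
    (hM : Module.support R M ⊆ PrimeSpectrum.zeroLocus I)
    (hN : Module.support R N ⊆ PrimeSpectrum.zeroLocus I)
    (h : ∀ p : PrimeSpectrum R, p.asIdeal ∈ I.minimalPrimes → localLength p M = localLength p N) :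
    F M = F N := by
  have hfin : {p : PrimeSpectrum R | p.asIdeal ∈ I.minimalPrimes}.Finite :=
    (I.finite_minimalPrimes_of_isNoetherianRing R).preimage
      (fun _ _ _ _ h => PrimeSpectrum.ext h)
  have hs : ∀ p, p ∈ hfin.toFinset ↔ p.asIdeal ∈ I.minimalPrimes := by simp
  rw [hF.eq_sum_localLength hF0 _ hs hM, hF.eq_sum_localLength hF0 _ hs hN]
  exact Finset.sum_congr rfl fun p hp => by rw [h p ((hs p).1 hp)]

end LocalLength

section HilbertSamuel

open Polynomial Filter

theorem Module.length_quotient_eq_one {R : Type*} [CommRing R] {I : Ideal R} (hI : I.IsMaximal) :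
    Module.length R (R ⧸ I) = 1 :=
  Module.length_eq_one_iff.2 (isSimpleModule_iff_isCoatom.2 hI.out)

theorem Module.length_ne_top_of_isMaximal {R : Type u} [CommRing R] [IsNoetherianRing R]
    {M : Type u} [AddCommGroup M] [Module R M] [Module.Finite R M]
    (hM : ∀ p ∈ Module.support R M, p.asIdeal.IsMaximal) : Module.length R M ≠ ⊤ := by
  refine induction_on_quotient_prime_of_support_subset {p | p.asIdeal.IsMaximal}
    (motive := fun N _ _ _ => Module.length R N ≠ ⊤) (fun N _ _ _ _ => ?_) (fun p hp => ?_)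
    (fun N₁ _ _ _ N₂ _ _ _ N₃ _ _ _ f g _ hf hg hfg h₁ h₃ => ?_) M hM
  · rw [Module.length_eq_zero]
    exact ENat.zero_ne_top
  · rw [Module.length_quotient_eq_one hp]
    exact ENat.one_ne_top
  · rw [Module.length_eq_add_of_exact f g hf hg hfg]
    exact WithTop.add_ne_top.2 ⟨h₁, h₃⟩

variable {R : Type u} [CommRing R] (J : Ideal R)

/-- The Hilbert–Samuel length function of `M` with respect to `J`. -/
noncomputable def hilbertSamuel (M : Type*) [AddCommGroup M] [Module R M] (n : ℕ) : ℚ :=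
  (Module.length R (M ⧸ (J ^ n • ⊤ : Submodule R M))).toNat

open Classical in
/-- The Hilbert–Samuel polynomial of `M` with respect to `J`, or zero if there is none. -/
noncomputable def hilbertSamuelPoly (M : Type*) [AddCommGroup M] [Module R M] : ℚ[X] :=
  if h : ∃ q : ℚ[X], ∀ᶠ n : ℕ in atTop, hilbertSamuel J M n = q.eval (n : ℚ) then h.choose else 0

variable {J}

theorem hilbertSamuel_nonneg (M : Type*) [AddCommGroup M] [Module R M] (n : ℕ) :
    0 ≤ hilbertSamuel J M n :=
  Nat.cast_nonneg _

/-- The length of `N ⧸ I N` is additive up to replacing `I N₁` by the preimage of `I N₂`. -/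
theorem length_quotient_smul_eq_add_of_exact {N₁ N₂ N₃ : Type*}
    [AddCommGroup N₁] [Module R N₁] [AddCommGroup N₂] [Module R N₂] [AddCommGroup N₃] [Module R N₃]
    (f : N₁ →ₗ[R] N₂) (g : N₂ →ₗ[R] N₃) (hg : Function.Surjective g)
    (hfg : Function.Exact f g) (I : Ideal R) :
    Module.length R (N₂ ⧸ (I • ⊤ : Submodule R N₂)) =
      Module.length R (N₁ ⧸ (I • ⊤ : Submodule R N₂).comap f) +
      Module.length R (N₃ ⧸ (I • ⊤ : Submodule R N₃)) := by
  have hcomap : (I • ⊤ : Submodule R N₃).comap g = I • ⊤ ⊔ LinearMap.range f := by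
    rw [← (LinearMap.exact_iff.1 hfg), ← Submodule.comap_map_eq, Submodule.map_smul'',
      Submodule.map_top, LinearMap.range_eq_top.2 hg]
  rw [length_quotient_eq_add (I • ⊤ : Submodule R N₂) ((I • ⊤ : Submodule R N₃).comap g)
    ((I • ⊤ : Submodule R N₂).mkQ ∘ₗ f) (by rw [hcomap]; exact le_sup_left)
    (by rw [hcomap, LinearMap.range_comp, Submodule.map_sup, Submodule.mkQ_map_self, bot_sup_eq]),
    LinearMap.ker_comp, Submodule.ker_mkQ]
  congr 1
  have hker : LinearMap.ker ((I • ⊤ : Submodule R N₃).mkQ ∘ₗ g) =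
      (I • ⊤ : Submodule R N₃).comap g := by
    rw [LinearMap.ker_comp, Submodule.ker_mkQ]
  rw [← hker]
  exact (LinearMap.quotKerEquivOfSurjective ((I • ⊤ : Submodule R N₃).mkQ ∘ₗ g)
    ((Submodule.mkQ_surjective _).comp hg)).length_eq

variable [IsNoetherianRing R] (hJ : ∀ p : PrimeSpectrum R, J ≤ p.asIdeal → p.asIdeal.IsMaximal)

include hJ

theorem length_quotient_pow_smul_ne_top (M : Type u) [AddCommGroup M] [Module R M]
    [Module.Finite R M] (n : ℕ) : Module.length R (M ⧸ (J ^ n • ⊤ : Submodule R M)) ≠ ⊤ := by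
  refine Module.length_ne_top_of_isMaximal fun p hp => hJ p ?_
  rw [Module.support_quotient] at hp
  exact p.2.le_of_pow_le hp.2

theorem hilbertSamuel_eventually_eq (M : Type u) [AddCommGroup M] [Module R M]
    [Module.Finite R M] :
    ∀ᶠ n : ℕ in atTop, hilbertSamuel J M n = (hilbertSamuelPoly J M).eval (n : ℚ) := by
  suffices h : ∃ q : ℚ[X], ∀ᶠ n : ℕ in atTop, hilbertSamuel J M n = q.eval (n : ℚ) by
    rw [hilbertSamuelPoly, dif_pos h]
    exact h.choose_spec
  obtain ⟨s, hs⟩ := IsNoetherian.noetherian J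
  have hJs : Ideal.span {a | a ∈ s.toList} = J := by simpa using hs
  have hle (n : ℕ) : (J ^ (n + 1) • ⊤ : Submodule R M) ≤ J ^ n • ⊤ :=
    Submodule.smul_mono_left (Ideal.pow_le_pow_right n.le_succ)
  have hmul (a : R) (ha : a ∈ s.toList) (n : ℕ) :
      (J ^ n • ⊤ : Submodule R M).map (LinearMap.lsmul R M a) ≤ J ^ (n + 1) • ⊤ := by
    rintro _ ⟨x, hx, rfl⟩
    rw [pow_succ', mul_smul]
    exact Submodule.smul_mem_smul (hJs ▸ Ideal.subset_span ha) hx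
  obtain ⟨q, hq⟩ := exists_polynomial_eventually_eq_length_sub s.toList
    (fun n => (J ^ (n + 1) • ⊤ : Submodule R M)) (fun n => J ^ n • ⊤) hle
    (fun n => length_quotient_pow_smul_ne_top hJ M (n + 1)) (fun a ha n => hmul a ha (n + 1)) hmul
    (fun H hFH hHG hH => by
      let F : J.Filtration M :=
        { N := H
          mono := fun n => (hHG (n + 1)).trans (hFH n)
          smul_le := fun n => by
            rw [← hJs, Submodule.smul_le]
            intro r hr x hx
            induction hr using Submodule.span_induction with
            | mem a ha => exact hH a ha n ⟨x, hx, rfl⟩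
            | zero => simp
            | add a b _ _ ha hb => rw [add_smul]; exact add_mem ha hb
            | smul c a _ ha => rw [smul_assoc]; exact Submodule.smul_mem _ c ha }
      have hF : F.Stable := (J.stableFiltration_stable (⊤ : Submodule R M)).of_le hHG
      obtain ⟨n₀, hn₀⟩ := hF
      refine ⟨n₀, fun n hn => ?_⟩
      rw [hJs]
      exact (hn₀ n hn).ge.trans le_sup_right)
  exact exists_polynomial_eventually_of_diff hq

theorem hilbertSamuel_mono (M : Type u) [AddCommGroup M] [Module R M] [Module.Finite R M] :
    Monotone (hilbertSamuel J M) := fun m n hmn => by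
  refine Nat.cast_le.2 (ENat.toNat_le_toNat ?_ (length_quotient_pow_smul_ne_top hJ M n))
  exact Module.length_le_of_surjective _ (Submodule.factor_surjective
    (Submodule.smul_mono_left (Ideal.pow_le_pow_right hmn)))

theorem hilbertSamuel_eq_add_of_exact {N₁ N₂ N₃ : Type u}
    [AddCommGroup N₁] [Module R N₁] [Module.Finite R N₁]
    [AddCommGroup N₂] [Module R N₂] [Module.Finite R N₂] [AddCommGroup N₃] [Module R N₃]
    [Module.Finite R N₃] (f : N₁ →ₗ[R] N₂) (g : N₂ →ₗ[R] N₃) (hg : Function.Surjective g)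
    (hfg : Function.Exact f g) (n : ℕ) :
    hilbertSamuel J N₂ n =
      (Module.length R (N₁ ⧸ (J ^ n • ⊤ : Submodule R N₂).comap f)).toNat +
      hilbertSamuel J N₃ n := by
  have h := length_quotient_smul_eq_add_of_exact f g hg hfg (J ^ n)
  have h0 := h ▸ length_quotient_pow_smul_ne_top hJ N₂ n
  rw [hilbertSamuel, h, ENat.toNat_add (WithTop.add_ne_top.1 h0).1 (WithTop.add_ne_top.1 h0).2,
    Nat.cast_add]
  rfl

theorem hilbertSamuel_le_add_of_exact {N₁ N₂ N₃ : Type u}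
    [AddCommGroup N₁] [Module R N₁] [Module.Finite R N₁]
    [AddCommGroup N₂] [Module R N₂] [Module.Finite R N₂] [AddCommGroup N₃] [Module R N₃]
    [Module.Finite R N₃] (f : N₁ →ₗ[R] N₂) (g : N₂ →ₗ[R] N₃) (hg : Function.Surjective g)
    (hfg : Function.Exact f g) (n : ℕ) :
    hilbertSamuel J N₂ n ≤ hilbertSamuel J N₁ n + hilbertSamuel J N₃ n := by
  rw [hilbertSamuel_eq_add_of_exact hJ f g hg hfg n]
  gcongr
  refine Nat.cast_le.2 (ENat.toNat_le_toNat ?_ (length_quotient_pow_smul_ne_top hJ N₁ n))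
  refine Module.length_le_of_surjective _ (Submodule.factor_surjective ?_)
  rw [← Submodule.map_le_iff_le_comap, Submodule.map_smul'']
  exact Submodule.smul_mono le_rfl le_top

/-- Superadditivity up to a shift, from the Artin–Rees lemma. -/
theorem exists_hilbertSamuel_sub_le_of_exact {N₁ N₂ N₃ : Type u}
    [AddCommGroup N₁] [Module R N₁] [Module.Finite R N₁]
    [AddCommGroup N₂] [Module R N₂] [Module.Finite R N₂] [AddCommGroup N₃] [Module R N₃]
    [Module.Finite R N₃] (f : N₁ →ₗ[R] N₂) (g : N₂ →ₗ[R] N₃) (hf : Function.Injective f)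
    (hg : Function.Surjective g) (hfg : Function.Exact f g) :
    ∃ c : ℕ, ∀ n ≥ c,
      hilbertSamuel J N₁ (n - c) + hilbertSamuel J N₃ n ≤ hilbertSamuel J N₂ n := by
  obtain ⟨c, hc⟩ := J.exists_pow_inf_eq_pow_smul (LinearMap.range f)
  refine ⟨c, fun n hn => ?_⟩
  rw [hilbertSamuel_eq_add_of_exact hJ f g hg hfg n]
  gcongr
  refine Nat.cast_le.2 (ENat.toNat_le_toNat ?_ ?_)
  · refine Module.length_le_of_surjective _ (Submodule.factor_surjective fun x hx => ?_)
    have hfx : f x ∈ J ^ n • ⊤ ⊓ LinearMap.range f := ⟨hx, x, rfl⟩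
    rw [hc n hn] at hfx
    have hle : J ^ (n - c) • (J ^ c • ⊤ ⊓ LinearMap.range f) ≤
        (J ^ (n - c) • ⊤ : Submodule R N₁).map f := by
      rw [Submodule.map_smul'', Submodule.map_top]
      exact Submodule.smul_mono le_rfl inf_le_right
    obtain ⟨y, hy, hyx⟩ := hle hfx
    exact hf hyx ▸ hy
  · refine ne_top_of_le_ne_top (length_quotient_pow_smul_ne_top hJ N₁ n) ?_
    refine Module.length_le_of_surjective _ (Submodule.factor_surjective ?_)
    rw [← Submodule.map_le_iff_le_comap, Submodule.map_smul'']
    exact Submodule.smul_mono le_rfl le_top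

open Pointwise in
theorem hilbertSamuel_succ_sub_le (M : Type u) [AddCommGroup M] [Module R M] [Module.Finite R M]
    {x : R} (hx : x ∈ J) (n : ℕ) :
    hilbertSamuel J M (n + 1) - hilbertSamuel J M n ≤
      hilbertSamuel J (QuotSMulTop x M) (n + 1) := by
  have hexact : Function.Exact (LinearMap.lsmul R M x) (x • ⊤ : Submodule R M).mkQ := by
    rw [LinearMap.exact_iff, Submodule.ker_mkQ]
    ext y
    simp [Submodule.mem_smul_pointwise_iff_exists]
  rw [hilbertSamuel_eq_add_of_exact hJ (LinearMap.lsmul R M x) (x • ⊤ : Submodule R M).mkQ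
    (Submodule.mkQ_surjective _) hexact (n + 1), sub_le_iff_le_add, add_comm]
  gcongr
  refine Nat.cast_le.2 (ENat.toNat_le_toNat ?_ (length_quotient_pow_smul_ne_top hJ M n))
  refine Module.length_le_of_surjective _ (Submodule.factor_surjective fun y hy => ?_)
  rw [Submodule.mem_comap, LinearMap.lsmul_apply, pow_succ', mul_smul]
  exact Submodule.smul_mem_smul hx hy

end HilbertSamuel

section HilbertSamuelPoly

open Polynomial Filter

theorem coheight_le_ringKrullDim_quotient {R : Type*} [CommRing R] {I : Ideal R}
    {p : PrimeSpectrum R} (hp : I ≤ p.asIdeal) :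
    (Order.coheight p : WithBot ℕ∞) ≤ ringKrullDim (R ⧸ I) := by
  rw [Order.coheight_eq_krullDim_Ici, ringKrullDim_quotient]
  exact Order.krullDim_le_of_strictMono
    (fun q : Set.Ici p => (⟨q.1, hp.trans q.2⟩ : PrimeSpectrum.zeroLocus (I : Set R)))
    (fun _ _ h => h)

variable {R : Type u} [CommRing R] [IsNoetherianRing R] {J : Ideal R}
  (hJ : ∀ p : PrimeSpectrum R, J ≤ p.asIdeal → p.asIdeal.IsMaximal)

include hJ

theorem hilbertSamuelPoly_degree_le_of_eventually_le {M : Type u} [AddCommGroup M] [Module R M]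
    [Module.Finite R M] {q : ℚ[X]}
    (h : ∀ᶠ n : ℕ in atTop, hilbertSamuel J M n ≤ q.eval (n : ℚ)) :
    (hilbertSamuelPoly J M).degree ≤ q.degree := by
  refine degree_le_of_eventually_le ?_ ?_
  · filter_upwards [hilbertSamuel_eventually_eq hJ M] with n hn
    exact hn ▸ hilbertSamuel_nonneg M n
  · filter_upwards [hilbertSamuel_eventually_eq hJ M, h] with n hn hn'
    exact hn ▸ hn'

theorem hilbertSamuelPoly_degree_le_of_succ_sub_le {M N : Type u} [AddCommGroup M] [Module R M]
    [Module.Finite R M] [AddCommGroup N] [Module R N] [Module.Finite R N] {k : ℕ}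
    (hN : (hilbertSamuelPoly J N).degree ≤ k)
    (h : ∀ n, hilbertSamuel J M (n + 1) - hilbertSamuel J M n ≤ hilbertSamuel J N (n + 1)) :
    (hilbertSamuelPoly J M).degree ≤ (k + 1 : ℕ) := by
  have hshift {P : Type u} [AddCommGroup P] [Module R P] [Module.Finite R P] :
      ∀ᶠ n : ℕ in atTop, hilbertSamuel J P (n + 1) =
        (taylor 1 (hilbertSamuelPoly J P)).eval (n : ℚ) := by
    filter_upwards [(tendsto_add_atTop_nat 1).eventually (hilbertSamuel_eventually_eq hJ P)]
      with n hn
    rw [hn, taylor_eval, Nat.cast_add, Nat.cast_one]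
  refine degree_le_of_taylor_sub ((degree_le_of_eventually_le
    (q := taylor 1 (hilbertSamuelPoly J N)) ?_ ?_).trans ((degree_taylor _ _).trans_le hN))
  · filter_upwards [hshift (P := M), hilbertSamuel_eventually_eq hJ M] with n h1 h2
    rw [eval_sub, ← h1, ← h2, sub_nonneg]
    exact hilbertSamuel_mono hJ M n.le_succ
  · filter_upwards [hshift (P := M), hilbertSamuel_eventually_eq hJ M, hshift (P := N)]
      with n h1 h2 h3
    rw [eval_sub, ← h1, ← h2, ← h3]
    exact h n

theorem hilbertSamuelPoly_quotient_degree_le_zero {p : PrimeSpectrum R}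
    (hp : p.asIdeal.IsMaximal) : (hilbertSamuelPoly J (R ⧸ p.asIdeal)).degree ≤ 0 := by
  refine (hilbertSamuelPoly_degree_le_of_eventually_le hJ (q := C 1)
    (Eventually.of_forall fun n => ?_)).trans degree_C_le
  rw [eval_C, hilbertSamuel, ← Nat.cast_one, Nat.cast_le]
  refine ENat.toNat_le_of_le_natCast ?_
  rw [Nat.cast_one, ← Module.length_quotient_eq_one hp]
  exact Module.length_le_of_surjective _ (Submodule.mkQ_surjective _)

theorem hilbertSamuelPoly_degree_le_of_forall_quotient {k : ℕ∞} {m : ℕ} {M : Type u}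
    [AddCommGroup M] [Module R M] [Module.Finite R M]
    (hM : ∀ p ∈ Module.support R M, Order.coheight p ≤ k)
    (h : ∀ p : PrimeSpectrum R, Order.coheight p ≤ k →
      (hilbertSamuelPoly J (R ⧸ p.asIdeal)).degree ≤ m) :
    (hilbertSamuelPoly J M).degree ≤ m := by
  refine induction_on_quotient_prime_of_support_subset {p : PrimeSpectrum R | Order.coheight p ≤ k}
    (motive := fun N _ _ _ => (hilbertSamuelPoly J N).degree ≤ m) (fun N _ _ _ _ => ?_)
    (fun p hp => h p hp)
    (fun N₁ _ _ _ N₂ _ _ _ N₃ _ _ _ f g _ hf hg hfg h₁ h₃ => ?_) M hM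
  · refine (hilbertSamuelPoly_degree_le_of_eventually_le hJ (q := 0)
      (Eventually.of_forall fun n => ?_)).trans (by simp)
    rw [hilbertSamuel, Module.length_eq_zero]
    simp
  · refine (hilbertSamuelPoly_degree_le_of_eventually_le hJ
      (q := hilbertSamuelPoly J N₁ + hilbertSamuelPoly J N₃) ?_).trans
      ((degree_add_le _ _).trans (max_le h₁ h₃))
    filter_upwards [hilbertSamuel_eventually_eq hJ N₁, hilbertSamuel_eventually_eq hJ N₃]
      with n h1 h3
    rw [eval_add, ← h1, ← h3]
    exact hilbertSamuel_le_add_of_exact hJ f g hg hfg n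

theorem hilbertSamuelPoly_degree_le (k : ℕ) (M : Type u) [AddCommGroup M] [Module R M]
    [Module.Finite R M] (hM : ∀ p ∈ Module.support R M, Order.coheight p ≤ k) :
    (hilbertSamuelPoly J M).degree ≤ k := by
  induction k generalizing M with
  | zero =>
    refine hilbertSamuelPoly_degree_le_of_forall_quotient hJ hM (fun p hp => ?_)
    refine hilbertSamuelPoly_quotient_degree_le_zero hJ ?_
    rw [Nat.cast_zero, nonpos_iff_eq_zero, Order.coheight_eq_zero] at hp
    obtain ⟨m, hm, hpm⟩ := p.asIdeal.exists_le_maximal p.2.ne_top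
    have hmp : (⟨m, hm.isPrime⟩ : PrimeSpectrum R) ≤ p := hp hpm
    exact le_antisymm hpm hmp ▸ hm
  | succ k ih =>
    refine hilbertSamuelPoly_degree_le_of_forall_quotient hJ hM (fun p hp => ?_)
    by_cases hJp : J ≤ p.asIdeal
    · exact (hilbertSamuelPoly_quotient_degree_le_zero hJ (hJ p hJp)).trans (by norm_cast; lia)
    · obtain ⟨x, hx, hxp⟩ := SetLike.not_le_iff_exists.1 hJp
      refine hilbertSamuelPoly_degree_le_of_succ_sub_le hJ
        (ih (QuotSMulTop x (R ⧸ p.asIdeal)) fun q hq => ?_)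
        (fun n => hilbertSamuel_succ_sub_le hJ _ hx n)
      rw [Module.support_quotSMulTop] at hq
      have hpq : p < q := lt_of_le_of_ne (Module.mem_support_quotient_iff.1 hq.1)
        (fun h => hxp (h ▸ hq.2 rfl))
      have := (Order.coheight_add_one_le hpq).trans hp
      rw [Nat.cast_add, Nat.cast_one] at this
      exact (ENat.add_le_add_iff_right ENat.one_ne_top).1 this

/-- Hilbert–Samuel polynomials are additive modulo polynomials of degree less than `d`, on modules
of dimension at most `d`. -/
theorem additiveOn_hilbertSamuelPoly (d : ℕ) {Z : Set (PrimeSpectrum R)}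
    (hZ : ∀ p ∈ Z, Order.coheight p ≤ d) :
    AdditiveOn Z (fun M _ _ => (degreeLT ℚ d).mkQ (hilbertSamuelPoly J M)) := by
  intro N₁ _ _ _ N₂ _ _ _ N₃ _ _ _ f g hN₂ hf hg hfg
  obtain ⟨c, hc⟩ := exists_hilbertSamuel_sub_le_of_exact hJ f g hf hg hfg
  have hN₁ : (hilbertSamuelPoly J N₁).degree ≤ d := hilbertSamuelPoly_degree_le hJ d N₁
    fun p hp => hZ p (hN₂ (Module.support_subset_of_injective f hf hp))
  have hev := (hilbertSamuel_eventually_eq hJ N₁).and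
    ((hilbertSamuel_eventually_eq hJ N₂).and (hilbertSamuel_eventually_eq hJ N₃))
  beta_reduce
  rw [← map_add, ← sub_eq_zero, ← map_sub, ← neg_eq_zero, ← map_neg, Submodule.mkQ_apply,
    Submodule.Quotient.mk_eq_zero, mem_degreeLT, neg_sub]
  refine (degree_le_of_eventually_le ?_ ?_).trans_lt (degree_sub_taylor_lt hN₁ (-c))
  · filter_upwards [hev] with n ⟨h1, h2, h3⟩
    rw [eval_sub, eval_add, ← h1, ← h2, ← h3, sub_nonneg]
    exact hilbertSamuel_le_add_of_exact hJ f g hg hfg n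
  · filter_upwards [hev, eventually_ge_atTop c,
      (tendsto_sub_atTop_nat c).eventually (hilbertSamuel_eventually_eq hJ N₁)]
      with n ⟨h1, h2, h3⟩ hn h4
    rw [Nat.cast_sub hn, sub_eq_add_neg] at h4
    rw [eval_sub, eval_add, eval_sub, taylor_eval, ← h1, ← h2, ← h3, ← h4]
    linarith [hc n hn]

theorem degree_hilbertSamuelPoly_sub_lt {I : Ideal R} {d : ℕ} (hI : ringKrullDim (R ⧸ I) ≤ d)
    {M N : Type u} [AddCommGroup M] [Module R M] [Module.Finite R M] [AddCommGroup N] [Module R N]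
    [Module.Finite R N]
    (hM : Module.support R M ⊆ PrimeSpectrum.zeroLocus I)
    (hN : Module.support R N ⊆ PrimeSpectrum.zeroLocus I)
    (h : ∀ p : PrimeSpectrum R, p.asIdeal ∈ I.minimalPrimes → localLength p M = localLength p N) :
    (hilbertSamuelPoly J M - hilbertSamuelPoly J N).degree < d := by
  have hco (p : PrimeSpectrum R) (hp : I ≤ p.asIdeal) : Order.coheight p ≤ d :=
    WithBot.coe_le_coe.1 ((coheight_le_ringKrullDim_quotient hp).trans hI)
  have hadd := additiveOn_hilbertSamuelPoly hJ d (Z := PrimeSpectrum.zeroLocus (I : Set R)) hco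
  have heq := hadd.eq_of_localLength_eq (fun p hp hpm => ?_) hM hN h
  · rwa [← sub_eq_zero, ← map_sub, Submodule.mkQ_apply, Submodule.Quotient.mk_eq_zero,
      mem_degreeLT] at heq
  · obtain ⟨q, hq, hqp⟩ := Ideal.exists_minimalPrimes_le hp
    have hlt : (⟨q, hq.1.1⟩ : PrimeSpectrum R) < p :=
      lt_of_le_of_ne hqp (fun h => hpm (h ▸ hq))
    have hcd := (Order.coheight_add_one_le hlt).trans (hco ⟨q, hq.1.1⟩ hq.1.2)
    obtain ⟨k, rfl⟩ : ∃ k, d = k + 1 := by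
      rcases d with - | k
      · simp at hcd
      · exact ⟨k, rfl⟩
    rw [Submodule.mkQ_apply, Submodule.Quotient.mk_eq_zero, mem_degreeLT]
    refine (hilbertSamuelPoly_degree_le hJ k _ fun r hr => ?_).trans_lt (by norm_cast; lia)
    rw [Module.mem_support_quotient_iff] at hr
    refine (Order.coheight_anti (show p ≤ r from hr)).trans ?_
    rw [Nat.cast_add, Nat.cast_one] at hcd
    exact (ENat.add_le_add_iff_right ENat.one_ne_top).1 hcd

end HilbertSamuelPoly

section KoszulChar

variable {R : Type u} [CommRing R]

open Pointwise in
theorem QuotSMulTop.exact_lsmul_mkQ (y : R) (M : Type*) [AddCommGroup M] [Module R M] :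
    Function.Exact (LinearMap.lsmul R M y) (y • (⊤ : Submodule R M)).mkQ := by
  intro x
  rw [Submodule.mkQ_apply, Submodule.Quotient.mk_eq_zero,
    Submodule.mem_smul_pointwise_iff_exists]
  simp

theorem Submodule.exact_torsionBy_subtype_lsmul (y : R) (M : Type*) [AddCommGroup M] [Module R M] :
    Function.Exact (Submodule.torsionBy R M y).subtype (LinearMap.lsmul R M y) := by
  intro x
  simp

/-- The Euler characteristic at `P` of the Koszul complex on `ys` with coefficients in `M`. -/
noncomputable def koszulChar (P : PrimeSpectrum R) :
    List R → (M : Type u) → [AddCommGroup M] → [Module R M] → ℤ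
  | [], M, _, _ => ((localLength P M).toNat : ℤ)
  | y :: ys, M, _, _ =>
    koszulChar P ys (QuotSMulTop y M) - koszulChar P ys (Submodule.torsionBy R M y)

/-- The primes that are compatible with finiteness of `koszulChar P ys`. -/
def koszulSupport (P : PrimeSpectrum R) (ys : List R) : Set (PrimeSpectrum R) :=
  {p | p.asIdeal ≤ P.asIdeal → Ideal.ofList ys ≤ p.asIdeal → p = P}

theorem mem_koszulSupport_of_cons {P p : PrimeSpectrum R} {y : R} {ys : List R}
    (h : p ∈ koszulSupport P (y :: ys)) (hy : y ∈ p.asIdeal) : p ∈ koszulSupport P ys :=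
  fun hpP hp => h hpP (by simp [hy, hp, Ideal.span_le])

theorem Submodule.support_torsionBy_subset (y : R) (M : Type*) [AddCommGroup M] [Module R M] :
    Module.support R (Submodule.torsionBy R M y) ⊆
      Module.support R M ∩ PrimeSpectrum.zeroLocus {y} := by
  refine Set.subset_inter (Module.support_subset_of_injective _ (Submodule.injective_subtype _)) ?_
  refine fun p hp => Set.singleton_subset_iff.2 ?_
  refine Module.annihilator_le_of_mem_support hp (Module.mem_annihilator.2 fun x => ?_)
  exact Submodule.smul_torsionBy y x

theorem support_torsionBy_subset_koszulSupport {P : PrimeSpectrum R} {y : R} {ys : List R}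
    {M : Type*} [AddCommGroup M] [Module R M]
    (h : Module.support R M ⊆ koszulSupport P (y :: ys)) :
    Module.support R (Submodule.torsionBy R M y) ⊆ koszulSupport P ys := fun _ hp =>
  have hp := Submodule.support_torsionBy_subset y M hp
  mem_koszulSupport_of_cons (h hp.1) (Set.singleton_subset_iff.1 hp.2)

theorem support_quotSMulTop_subset_koszulSupport {P : PrimeSpectrum R} {y : R} {ys : List R}
    {M : Type*} [AddCommGroup M] [Module R M] [Module.Finite R M]
    (h : Module.support R M ⊆ koszulSupport P (y :: ys)) :
    Module.support R (QuotSMulTop y M) ⊆ koszulSupport P ys := fun _ hp =>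
  have hp := (Module.support_quotSMulTop (M := M) y).subset hp
  mem_koszulSupport_of_cons (h hp.1) (Set.singleton_subset_iff.1 hp.2)

theorem localLength_eq_of_linearEquiv (p : PrimeSpectrum R) {M N : Type*} [AddCommGroup M]
    [Module R M] [AddCommGroup N] [Module R N] (e : M ≃ₗ[R] N) :
    localLength p M = localLength p N := by
  have h := localLength_eq_add_of_exact p e.toLinearMap (0 : N →ₗ[R] PUnit.{1}) e.injective
    (Function.surjective_to_subsingleton _)
    ((e.toLinearMap.exact_zero_iff_surjective _).2 e.surjective)
  have h0 : localLength p PUnit.{1} = 0 :=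
    (localLength_eq_zero_iff p).2 (by rw [Module.support_eq_empty]; exact Set.notMem_empty p)
  rw [h, h0, add_zero]

variable [IsNoetherianRing R]

theorem additiveOn_koszulChar (P : PrimeSpectrum R) (ys : List R) :
    AdditiveOn (koszulSupport P ys) (fun M _ _ => koszulChar P ys M) := by
  induction ys with
  | nil =>
    exact additiveOn_localLength P _ fun p hp hpP => hp hpP (by simp)
  | cons y ys ih =>
    intro N₁ _ _ _ N₂ _ _ _ N₃ _ _ _ f g hN₂ hf hg hfg
    have hN₁ := (Module.support_subset_of_injective f hf).trans hN₂
    have hN₃ := (Module.support_subset_of_surjective g hg).trans hN₂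
    let m (M : Type u) [AddCommGroup M] [Module R M] : M →ₗ[R] M := LinearMap.lsmul R M y
    have hι (M : Type u) [AddCommGroup M] [Module R M] :=
      Submodule.exact_torsionBy_subtype_lsmul y M
    have hπ (M : Type u) [AddCommGroup M] [Module R M] := QuotSMulTop.exact_lsmul_mkQ y M
    let f' : Submodule.torsionBy R N₁ y →ₗ[R] Submodule.torsionBy R N₂ y :=
      f.restrict fun x hx => by
        rw [Submodule.mem_torsionBy_iff] at hx ⊢
        rw [← map_smul, hx, map_zero]
    let g' : Submodule.torsionBy R N₂ y →ₗ[R] Submodule.torsionBy R N₃ y :=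
      g.restrict fun x hx => by
        rw [Submodule.mem_torsionBy_iff] at hx ⊢
        rw [← map_smul, hx, map_zero]
    have hf' : Function.Injective f' := fun a b h =>
      Subtype.ext (hf (congrArg Subtype.val h))
    have hfg' : Function.Exact f' g' := by
      intro x
      refine ⟨fun hx => ?_, ?_⟩
      · obtain ⟨a, ha⟩ := (hfg x.1).1 (congrArg Subtype.val hx)
        refine ⟨⟨a, ?_⟩, Subtype.ext ha⟩
        rw [Submodule.mem_torsionBy_iff]
        refine hf ?_
        rw [map_smul, ha, map_zero]
        exact x.2
      · rintro ⟨a, rfl⟩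
        exact Subtype.ext (hfg.apply_apply_eq_zero a.1)
    have h₁ : f.comp (m N₁) = (m N₂).comp f := by ext; simp [m]
    have h₂ : g.comp (m N₂) = (m N₃).comp g := by ext; simp [m]
    have := ih.six_term (support_torsionBy_subset_koszulSupport hN₁)
      (support_torsionBy_subset_koszulSupport hN₂) (support_torsionBy_subset_koszulSupport hN₃)
      (support_quotSMulTop_subset_koszulSupport hN₁) (support_quotSMulTop_subset_koszulSupport hN₂)
      hf' hfg'
      (SnakeLemma.exact_δ'_right (m N₁) (m N₂) (m N₃) f g hfg f g hfg h₁ h₂ _ (hι N₂) _ (hι N₃) _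
        (hπ N₁) hg hf g' rfl (Submodule.injective_subtype _))
      (SnakeLemma.exact_δ'_left (m N₁) (m N₂) (m N₃) f g hfg f g hfg h₁ h₂ _ (hι N₃) _ (hπ N₁) _
        (hπ N₂) hg hf (QuotSMulTop.map y f) rfl (Submodule.mkQ_surjective _))
      (QuotSMulTop.map_exact y hfg hg) (QuotSMulTop.map_surjective y hg)
    beta_reduce at this ⊢
    simp only [koszulChar]
    linarith

open Pointwise in
theorem koszulChar_eq_zero {P : PrimeSpectrum R} (ys : List R) {M : Type u} [AddCommGroup M]
    [Module R M] [Module.Finite R M] (hM : Module.support R M ⊆ koszulSupport P ys ∩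
      {p : PrimeSpectrum R | p.asIdeal ≤ P.asIdeal →
        P.asIdeal.height < p.asIdeal.height + ys.length}) :
    koszulChar P ys M = 0 := by
  induction ys generalizing M with
  | nil =>
    rw [koszulChar, (localLength_eq_zero_iff P).2 fun h => by simpa using (hM h).2 le_rfl]
    simp
  | cons y ys ih =>
    set Z : Set (PrimeSpectrum R) := koszulSupport P (y :: ys) ∩ {p : PrimeSpectrum R |
      p.asIdeal ≤ P.asIdeal → P.asIdeal.height < p.asIdeal.height + (y :: ys).length} with hZ
    have hZ' : {q | Module.support R (R ⧸ q.asIdeal) ⊆ Z} ⊆ Z := fun q hq =>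
      hq (Module.mem_support_quotient_iff.2 le_rfl)
    refine induction_on_quotient_prime_of_support_subset
      {q | Module.support R (R ⧸ q.asIdeal) ⊆ Z}
      (motive := fun N _ _ _ => koszulChar P (y :: ys) N = 0) (fun N _ _ _ _ => ?_)
      (fun q hq => ?_) (fun N₁ _ _ _ N₂ _ _ _ N₃ _ _ _ f g hN₂ hf hg hfg h₁ h₃ => ?_) M
      fun q hq p hp => hM (Module.mem_support_mono (Module.mem_support_quotient_iff.1 hp) hq)
    · exact (additiveOn_koszulChar P (y :: ys)).eq_zero_of_subsingleton N
    · have hq' := Set.subset_inter_iff.1 hq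
      have hann : ∀ x : R ⧸ q.asIdeal, y • x = 0 ↔ y ∈ q.asIdeal ∨ x = 0 := by
        intro x
        obtain ⟨x, rfl⟩ := Ideal.Quotient.mk_surjective x
        rw [← Ideal.Quotient.mk_eq_mk, ← Submodule.Quotient.mk_smul, Submodule.Quotient.mk_eq_zero,
          Submodule.Quotient.mk_eq_zero, smul_eq_mul, q.2.mul_mem_iff_mem_or_mem]
      rw [koszulChar]
      by_cases hy : y ∈ q.asIdeal
      · have h0 : ∀ x : R ⧸ q.asIdeal, y • x = 0 := fun x => (hann x).2 (Or.inl hy)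
        have hbot : y • (⊤ : Submodule R (R ⧸ q.asIdeal)) = ⊥ := by
          rw [eq_bot_iff]
          rintro _ ⟨x, -, rfl⟩
          exact h0 x
        have htop : Submodule.torsionBy R (R ⧸ q.asIdeal) y = ⊤ :=
          eq_top_iff.2 fun x _ => (Submodule.mem_torsionBy_iff y x).2 (h0 x)
        rw [sub_eq_zero]
        exact (additiveOn_koszulChar P ys).eq_of_linearEquiv
          (support_quotSMulTop_subset_koszulSupport hq'.1)
          ((Submodule.quotEquivOfEqBot _ hbot).trans
            ((LinearEquiv.ofTop _ htop).symm))
      · have : Subsingleton (Submodule.torsionBy R (R ⧸ q.asIdeal) y) :=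
          ⟨fun a b => Subtype.ext ((((hann a.1).1 a.2).resolve_left hy).trans
            (((hann b.1).1 b.2).resolve_left hy).symm)⟩
        rw [(additiveOn_koszulChar P ys).eq_zero_of_subsingleton (Submodule.torsionBy R _ y),
          sub_zero]
        refine ih (Set.subset_inter (support_quotSMulTop_subset_koszulSupport hq'.1) ?_)
        intro p hp hpP
        have hp' := (Module.support_quotSMulTop (M := R ⧸ q.asIdeal) y).subset hp
        have hqp : q.asIdeal < p.asIdeal :=
          lt_of_le_of_ne (Module.mem_support_quotient_iff.1 hp'.1)
            fun h => hy (h ▸ Set.singleton_subset_iff.1 hp'.2)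
        have h1 := (hZ' hq).2 (hqp.le.trans hpP)
        have h2 : q.asIdeal.height + 1 ≤ p.asIdeal.height :=
          Order.add_one_le_of_lt (Ideal.height_strict_mono_of_isPrime hqp)
        refine h1.trans_le ?_
        rw [List.length_cons, Nat.cast_add, add_comm (ys.length : ℕ∞), ← add_assoc, Nat.cast_one]
        gcongr
    · have hN₂' := hN₂.trans (hZ'.trans Set.inter_subset_left)
      have := additiveOn_koszulChar P (y :: ys) N₁ N₂ N₃ f g hN₂' hf hg hfg
      beta_reduce at this
      rw [this, h₁, h₃, add_zero]

theorem koszulChar_eq_localLength {P : PrimeSpectrum R} {ys : List R} {M : Type u}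
    [AddCommGroup M] [Module R M] [Module.Finite R M]
    (hM : RingTheory.Sequence.IsWeaklyRegular M ys) :
    koszulChar P ys M =
      ((localLength P (M ⧸ Ideal.ofList ys • (⊤ : Submodule R M))).toNat : ℤ) := by
  induction ys generalizing M with
  | nil =>
    rw [koszulChar, localLength_eq_of_linearEquiv P
      (Submodule.quotEquivOfEqBot (Ideal.ofList ([] : List R) • (⊤ : Submodule R M)) (by simp))]
  | cons y ys ih =>
    rw [RingTheory.Sequence.isWeaklyRegular_cons_iff, isSMulRegular_iff_torsionBy_eq_bot] at hM
    have := Submodule.subsingleton_iff_eq_bot.2 hM.1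
    rw [koszulChar,
      (additiveOn_koszulChar P ys).eq_zero_of_subsingleton (Submodule.torsionBy R M y),
      sub_zero, ih hM.2,
      localLength_eq_of_linearEquiv P (Submodule.quotOfListConsSMulTopEquivQuotSMulTopInner M y ys)]

/-- If `M` and `N` have the same local lengths at the minimal primes of `R`, then so do their
quotients by a sequence that is weakly regular on both, at the minimal primes of the sequence. -/
theorem localLength_quotient_ofList_eq {P : PrimeSpectrum R} {ys : List R}
    (hP : P.asIdeal ∈ (Ideal.ofList ys).minimalPrimes) {M N : Type u} [AddCommGroup M] [Module R M]
    [Module.Finite R M] [AddCommGroup N] [Module R N] [Module.Finite R N]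
    (hM : RingTheory.Sequence.IsWeaklyRegular M ys) (hN : RingTheory.Sequence.IsWeaklyRegular N ys)
    (h : ∀ p : PrimeSpectrum R, p.asIdeal ∈ minimalPrimes R → localLength p M = localLength p N) :
    localLength P (M ⧸ Ideal.ofList ys • (⊤ : Submodule R M)) =
      localLength P (N ⧸ Ideal.ofList ys • (⊤ : Submodule R N)) := by
  have huniv : ∀ p, p ∈ koszulSupport P ys := fun p hpP hp =>
    PrimeSpectrum.ext (hpP.antisymm (hP.2 ⟨p.2, hp⟩ hpP))
  have hne (L : Type u) [AddCommGroup L] [Module R L] [Module.Finite R L] :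
      localLength P (L ⧸ Ideal.ofList ys • (⊤ : Submodule R L)) ≠ ⊤ :=
    localLength_ne_top P fun p hp hpP =>
      huniv p hpP ((Module.support_quotient _).subset hp).2
  have hht : P.asIdeal.height ≤ ys.length := by
    classical
    refine (Ideal.height_le_card_of_mem_minimalPrimes_span_finset (s := ys.toFinset) ?_).trans
      (by exact_mod_cast List.toFinset_card_le ys)
    simpa [Ideal.ofList] using hP
  have hχ : koszulChar P ys M = koszulChar P ys N := by
    refine AdditiveOn.eq_of_localLength_eq (I := ⊥) (F := fun L _ _ => koszulChar P ys L)
      (fun N₁ _ _ _ N₂ _ _ _ N₃ _ _ _ f g _ => additiveOn_koszulChar P ys N₁ N₂ N₃ f g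
        fun p _ => huniv p) (fun p _ hp => ?_) (by simp) (by simp) h
    refine koszulChar_eq_zero ys fun q hq => ⟨huniv q, fun _ => ?_⟩
    have hq0 : 1 ≤ q.asIdeal.height := by
      rw [Order.one_le_iff_ne_zero, Ne, Ideal.height_eq_zero_iff]
      intro hq0
      have hpq := Module.mem_support_quotient_iff.1 hq
      exact hp (le_antisymm hpq (hq0.2 ⟨p.2, bot_le⟩ hpq) ▸ hq0)
    refine (ENat.add_one_le_iff (ne_top_of_le_ne_top (ENat.natCast_ne_top _) hht)).1 ?_
    rw [add_comm]
    gcongr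
  rw [koszulChar_eq_localLength hM, koszulChar_eq_localLength hN, Nat.cast_inj] at hχ
  exact by rw [← ENat.natCast_toNat (hne M), hχ, ENat.natCast_toNat (hne N)]

end KoszulChar

section ExtComparison

open CategoryTheory Abelian

variable {R : Type} [CommRing R]

theorem exactAt_linearYonedaObj_iff {C : Type*} [Category* C] [Abelian C] [Linear R C]
    (X : ChainComplex C ℕ) (Y : C) (i j k : ℕ) (hij : i + 1 = j) (hjk : j + 1 = k) :
    (X.linearYonedaObj R Y).ExactAt j ↔
      ∀ f : X.X j ⟶ Y, X.d k j ≫ f = 0 → ∃ g : X.X i ⟶ Y, X.d j i ≫ g = f := by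
  rw [HomologicalComplex.exactAt_iff' _ i j k ((ComplexShape.up ℕ).prev_eq' hij)
    ((ComplexShape.up ℕ).next_eq' hjk), ShortComplex.moduleCat_exact_iff]
  rfl

theorem subsingleton_extModule_iff (M N : ModuleCat.{0} R) (i : ℕ) (hi : 0 < i) :
    Subsingleton (ExtModule R M N i) ↔ Subsingleton (Ext.{0} M N i) := by
  obtain ⟨n, rfl⟩ := Nat.exists_eq_succ_of_ne_zero hi.ne'
  let P := projectiveResolution M
  have h1 : Subsingleton (ExtModule R M N (n + 1)) ↔
      (P.complex.linearYonedaObj R N).ExactAt (n + 1) := by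
    rw [HomologicalComplex.exactAt_iff_isZero_homology, ← (P.isoExt (n + 1) N).isZero_iff,
      ModuleCat.isZero_iff_subsingleton]
    rfl
  rw [Nat.succ_eq_add_one, h1, exactAt_linearYonedaObj_iff P.complex N n (n + 1) (n + 2) rfl rfl]
  constructor
  · intro h
    refine subsingleton_of_forall_eq 0 fun x => ?_
    obtain ⟨f, hf, rfl⟩ := P.extMk_surjective x (n + 2) rfl
    rw [P.extMk_eq_zero_iff f (n + 2) rfl hf n rfl]
    exact h f hf
  · intro h f hf
    exact (P.extMk_eq_zero_iff f (n + 2) rfl hf n rfl).1 (Subsingleton.elim _ _)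

variable {N₁ N₂ N₃ : Type} [AddCommGroup N₁] [Module R N₁] [AddCommGroup N₂] [Module R N₂]
  [AddCommGroup N₃] [Module R N₃] {f : N₁ →ₗ[R] N₂} {g : N₂ →ₗ[R] N₃}

theorem ModuleCat.shortExact_of_linearMap (hf : Function.Injective f) (hg : Function.Surjective g)
    (hfg : Function.Exact f g) :
    (ShortComplex.mk (ModuleCat.ofHom f) (ModuleCat.ofHom g)
      (ModuleCat.hom_ext (LinearMap.ext hfg.apply_apply_eq_zero))).ShortExact where
  exact := (ShortComplex.ShortExact.moduleCat_exact_iff_function_exact _).2 hfg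
  mono_f := (ModuleCat.mono_iff_injective _).2 hf
  epi_g := (ModuleCat.epi_iff_surjective _).2 hg

theorem subsingleton_ext_right_of_exact (X : ModuleCat.{0} R) (hf : Function.Injective f)
    (hg : Function.Surjective g) (hfg : Function.Exact f g) (i : ℕ)
    (h₂ : Subsingleton (Ext.{0} X (ModuleCat.of R N₂) i))
    (h₁ : Subsingleton (Ext.{0} X (ModuleCat.of R N₁) (i + 1))) :
    Subsingleton (Ext.{0} X (ModuleCat.of R N₃) i) := by
  refine subsingleton_of_forall_eq 0 fun x => ?_
  obtain ⟨y, rfl⟩ := Ext.covariant_sequence_exact₃ X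
    (ModuleCat.shortExact_of_linearMap hf hg hfg) x rfl
    (Subsingleton.elim (α := Ext X (ModuleCat.of R N₁) (i + 1)) _ _)
  rw [Subsingleton.elim (α := Ext X (ModuleCat.of R N₂) i) y 0, Ext.zero_comp]

theorem exists_lift_of_subsingleton_ext_one {X : Type} [AddCommGroup X] [Module R X]
    (hf : Function.Injective f)
    (hg : Function.Surjective g) (hfg : Function.Exact f g)
    (h₁ : Subsingleton (Ext.{0} (ModuleCat.of R X) (ModuleCat.of R N₁) 1))
    (φ : X →ₗ[R] N₃) : ∃ ψ : X →ₗ[R] N₂, g ∘ₗ ψ = φ := by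
  obtain ⟨y, hy⟩ := Ext.covariant_sequence_exact₃ (ModuleCat.of R X)
    (ModuleCat.shortExact_of_linearMap hf hg hfg) (Ext.mk₀ (ModuleCat.ofHom φ))
    (zero_add 1) (Subsingleton.elim (α := Ext (ModuleCat.of R X) (ModuleCat.of R N₁) 1) _ _)
  obtain ⟨ψ, rfl⟩ := Ext.addEquiv₀.symm.surjective y
  refine ⟨ψ.hom, ?_⟩
  rw [Ext.addEquiv₀_symm_apply, Ext.mk₀_comp_mk₀] at hy
  exact congrArg ModuleCat.Hom.hom (Ext.addEquiv₀.symm.injective hy)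

theorem subsingleton_ext_left_of_exact (Y : ModuleCat.{0} R) (hf : Function.Injective f)
    (hg : Function.Surjective g) (hfg : Function.Exact f g) (i : ℕ)
    (h₁ : Subsingleton (Ext.{0} (ModuleCat.of R N₁) Y i))
    (h₃ : Subsingleton (Ext.{0} (ModuleCat.of R N₃) Y i)) :
    Subsingleton (Ext.{0} (ModuleCat.of R N₂) Y i) := by
  refine subsingleton_of_forall_eq 0 fun x => ?_
  obtain ⟨y, rfl⟩ := Ext.contravariant_sequence_exact₂
    (ModuleCat.shortExact_of_linearMap hf hg hfg) Y x
    (Subsingleton.elim (α := Ext (ModuleCat.of R N₁) Y i) _ _)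
  rw [Subsingleton.elim (α := Ext (ModuleCat.of R N₃) Y i) y 0, Ext.comp_zero]

theorem subsingleton_ext_left_of_exact' (Y : ModuleCat.{0} R) (hf : Function.Injective f)
    (hg : Function.Surjective g) (hfg : Function.Exact f g) (i : ℕ)
    (h₂ : Subsingleton (Ext.{0} (ModuleCat.of R N₂) Y i))
    (h₃ : Subsingleton (Ext.{0} (ModuleCat.of R N₃) Y (i + 1))) :
    Subsingleton (Ext.{0} (ModuleCat.of R N₁) Y i) := by
  refine subsingleton_of_forall_eq 0 fun x => ?_
  obtain ⟨y, rfl⟩ := Ext.contravariant_sequence_exact₁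
    (ModuleCat.shortExact_of_linearMap hf hg hfg) Y x (add_comm 1 i)
    (Subsingleton.elim (α := Ext (ModuleCat.of R N₃) Y (i + 1)) _ _)
  rw [Subsingleton.elim (α := Ext (ModuleCat.of R N₂) Y i) y 0, Ext.comp_zero]

theorem exists_extension_of_subsingleton_ext_one {Y : Type} [AddCommGroup Y] [Module R Y]
    (hf : Function.Injective f)
    (hg : Function.Surjective g) (hfg : Function.Exact f g)
    (h₃ : Subsingleton (Ext.{0} (ModuleCat.of R N₃) (ModuleCat.of R Y) 1))
    (φ : N₁ →ₗ[R] Y) : ∃ ψ : N₂ →ₗ[R] Y, ψ ∘ₗ f = φ := by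
  obtain ⟨y, hy⟩ := Ext.contravariant_sequence_exact₁
    (ModuleCat.shortExact_of_linearMap hf hg hfg) (ModuleCat.of R Y) (Ext.mk₀ (ModuleCat.ofHom φ))
    (add_zero 1) (Subsingleton.elim (α := Ext (ModuleCat.of R N₃) (ModuleCat.of R Y) 1) _ _)
  obtain ⟨ψ, rfl⟩ := Ext.addEquiv₀.symm.surjective y
  refine ⟨ψ.hom, ?_⟩
  rw [Ext.addEquiv₀_symm_apply, Ext.mk₀_comp_mk₀] at hy
  exact congrArg ModuleCat.Hom.hom (Ext.addEquiv₀.symm.injective hy)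

end ExtComparison

section HomRegular

open CategoryTheory Abelian

variable {R : Type} [CommRing R]

theorem QuotSMulTop.exists_smul_eq_of_mkQ_comp_eq_zero {C M : Type*} [AddCommGroup C] [Module R C]
    [AddCommGroup M] [Module R M] {y : R} (hy : IsSMulRegular M y) {φ : C →ₗ[R] M}
    (hφ : (Submodule.mkQ _ : M →ₗ[R] QuotSMulTop y M) ∘ₗ φ = 0) :
    ∃ ψ : C →ₗ[R] M, y • ψ = φ := by
  have hinj : Function.Injective (LinearMap.lsmul R M y) := hy
  have hmem (c : C) : φ c ∈ LinearMap.range (LinearMap.lsmul R M y) :=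
    (QuotSMulTop.exact_lsmul_mkQ y M (φ c)).1 (LinearMap.congr_fun hφ c)
  refine ⟨(LinearEquiv.ofInjective _ hinj).symm.toLinearMap ∘ₗ φ.codRestrict _ hmem, ?_⟩
  ext c
  exact congrArg Subtype.val
    ((LinearEquiv.ofInjective _ hinj).apply_symm_apply (φ.codRestrict _ hmem c))

open Pointwise in
/-- If `Ext¹(C, M) = 0` then `Hom(C, -)` commutes with the quotient of `M` by a regular element. -/
theorem QuotSMulTop.nonempty_linearMap_equiv {C M : Type} [AddCommGroup C] [Module R C]
    [AddCommGroup M] [Module R M] {y : R} (hy : IsSMulRegular M y)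
    (hExt : Subsingleton (Ext.{0} (ModuleCat.of R C) (ModuleCat.of R M) 1)) :
    Nonempty (QuotSMulTop y (C →ₗ[R] M) ≃ₗ[R] (C →ₗ[R] QuotSMulTop y M)) := by
  let π : M →ₗ[R] QuotSMulTop y M := Submodule.mkQ _
  let Φ : (C →ₗ[R] M) →ₗ[R] (C →ₗ[R] QuotSMulTop y M) := LinearMap.llcomp R C M _ π
  have hΦ : Function.Surjective Φ := fun φ =>
    exists_lift_of_subsingleton_ext_one (f := LinearMap.lsmul R M y) (g := π) hy
      (Submodule.mkQ_surjective _) (QuotSMulTop.exact_lsmul_mkQ y M) hExt φ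
  have hker : y • (⊤ : Submodule R (C →ₗ[R] M)) = LinearMap.ker Φ := by
    ext φ
    rw [Submodule.mem_smul_pointwise_iff_exists, LinearMap.mem_ker]
    constructor
    · rintro ⟨ψ, -, rfl⟩
      ext c
      exact (QuotSMulTop.exact_lsmul_mkQ y M (y • ψ c)).2 ⟨ψ c, rfl⟩
    · intro h
      obtain ⟨ψ, hψ⟩ := QuotSMulTop.exists_smul_eq_of_mkQ_comp_eq_zero hy h
      exact ⟨ψ, trivial, hψ⟩
  exact ⟨(Submodule.quotEquivOfEq _ _ hker).trans (Φ.quotKerEquivOfSurjective hΦ)⟩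

theorem IsSMulRegular.of_linearMap [IsNoetherianRing R] {C M : Type*} [AddCommGroup C] [Module R C]
    [Module.Finite R C] [AddCommGroup M] [Module R M] [Module.Finite R M]
    (hC : Module.annihilator R C = ⊥) {y : R} (hy : IsSMulRegular (C →ₗ[R] M) y) :
    IsSMulRegular M y := by
  have h0 : Subsingleton (QuotSMulTop y C →ₗ[R] M) := by
    refine subsingleton_of_forall_eq 0 fun φ => ?_
    have h : φ ∘ₗ Submodule.mkQ _ = (0 : C →ₗ[R] M) := by
      refine hy (LinearMap.ext fun c => ?_)
      have : (Submodule.mkQ _ : C →ₗ[R] QuotSMulTop y C) (y • c) = 0 :=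
        (QuotSMulTop.exact_lsmul_mkQ y C (y • c)).2 ⟨c, rfl⟩
      simpa using congrArg φ this
    exact LinearMap.cancel_right (Submodule.mkQ_surjective _) |>.1
      (h.trans (LinearMap.zero_comp _).symm)
  obtain ⟨a, ha, hreg⟩ := IsSMulRegular.subsingleton_linearMap_iff.1 h0
  have hrad : a ∈ (Ideal.span {y}).radical := by
    rw [Ideal.radical_eq_sInf, Ideal.mem_sInf]
    rintro p ⟨hyp, hp⟩
    have hmem : (⟨p, hp⟩ : PrimeSpectrum R) ∈ Module.support R (QuotSMulTop y C) := by
      rw [Module.support_quotSMulTop]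
      exact ⟨Module.mem_support_iff_of_finite.2 (hC ▸ bot_le),
        Set.singleton_subset_iff.2 (hyp (Ideal.mem_span_singleton_self y))⟩
    exact Module.mem_support_iff_of_finite.1 hmem ha
  obtain ⟨n, hn⟩ := hrad
  obtain ⟨b, hb⟩ := Ideal.mem_span_singleton'.1 hn
  exact IsSMulRegular.of_mul (a := b) (by simpa [hb] using hreg.pow n)

theorem isWeaklyRegular_of_linearMap [IsNoetherianRing R] {C M : Type} [AddCommGroup C] [Module R C]
    [Module.Finite R C] [AddCommGroup M] [Module R M] [Module.Finite R M]
    (hC : Module.annihilator R C = ⊥)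
    (hExt : ∀ i, 0 < i → Subsingleton (Ext.{0} (ModuleCat.of R C) (ModuleCat.of R M) i))
    {ys : List R} (hys : RingTheory.Sequence.IsWeaklyRegular (C →ₗ[R] M) ys) :
    RingTheory.Sequence.IsWeaklyRegular M ys := by
  induction ys generalizing M with
  | nil => exact .nil R M
  | cons y ys ih =>
    rw [RingTheory.Sequence.isWeaklyRegular_cons_iff] at hys ⊢
    have hy : IsSMulRegular M y := .of_linearMap hC hys.1
    obtain ⟨e⟩ := QuotSMulTop.nonempty_linearMap_equiv hy (hExt 1 one_pos)
    refine ⟨hy, ih (fun i hi => ?_) ((e.isWeaklyRegular_congr ys).1 hys.2)⟩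
    exact subsingleton_ext_right_of_exact (f := LinearMap.lsmul R M y)
      (g := (Submodule.mkQ _ : M →ₗ[R] QuotSMulTop y M)) _ hy
      (Submodule.mkQ_surjective _) (QuotSMulTop.exact_lsmul_mkQ y M) i (hExt i hi)
      (hExt (i + 1) i.succ_pos)

end HomRegular

section Artinian

open CategoryTheory Abelian

variable {A : Type} [CommRing A] [IsLocalRing A] [IsNoetherianRing A]

open IsLocalRing

theorem exists_injective_linearMap_quotient_maximalIdeal
    (hA : ∀ P : Ideal A, P.IsPrime → P = maximalIdeal A) :
    ∃ ι : (A ⧸ maximalIdeal A) →ₗ[A] A, Function.Injective ι := by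
  obtain ⟨P, hP⟩ := associatedPrimes.nonempty A A
  obtain ⟨hP, ι, hι⟩ := (isAssociatedPrime_iff_exists_injective_linearMap _ _).1 hP
  obtain rfl := hA P hP
  exact ⟨ι, hι⟩

/-- Over a zero-dimensional local ring of finite injective dimension, all higher `Ext`s into the
ring vanish. -/
theorem subsingleton_ext_of_eventually (hA : ∀ P : Ideal A, P.IsPrime → P = maximalIdeal A) {n : ℕ}
    (hn : ∀ (N : ModuleCat.{0} A) (i : ℕ), n < i → Subsingleton (Ext.{0} N (ModuleCat.of A A) i))
    (N : Type) [AddCommGroup N] [Module A N] [Module.Finite A N] {i : ℕ} (hi : 0 < i) :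
    Subsingleton (Ext.{0} (ModuleCat.of A N) (ModuleCat.of A A) i) := by
  obtain ⟨ι, hι⟩ := exists_injective_linearMap_quotient_maximalIdeal hA
  suffices H : ∀ k i, 0 < i → n < i + k → ∀ (N : Type) [AddCommGroup N] [Module A N]
      [Module.Finite A N], Subsingleton (Ext.{0} (ModuleCat.of A N) (ModuleCat.of A A) i) from
    H (n + 1) i hi (by lia) N
  intro k
  induction k with
  | zero => exact fun i _ h N _ _ _ => hn _ i h
  | succ k ih =>
    intro i hi h N _ _ _
    have hk : Subsingleton
        (Ext.{0} (ModuleCat.of A (A ⧸ maximalIdeal A)) (ModuleCat.of A A) i) := by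
      refine subsingleton_ext_left_of_exact' _ hι (Submodule.mkQ_surjective (LinearMap.range ι))
        (LinearMap.exact_map_mkQ_range ι) i ?_ (ih (i + 1) i.succ_pos (by lia) _)
      obtain ⟨i, rfl⟩ := Nat.exists_eq_succ_of_ne_zero hi.ne'
      have : Projective (ModuleCat.of A A) := (IsProjective.iff_projective A).1 inferInstance
      exact subsingleton_of_forall_eq 0 fun x => Ext.eq_zero_of_projective x
    have hsub : ∀ (N : Type) [AddCommGroup N] [Module A N] [Subsingleton N],
        Subsingleton (Ext.{0} (ModuleCat.of A N) (ModuleCat.of A A) i) := by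
      intro N _ _ _
      have h0 := ModuleCat.isZero_of_subsingleton (ModuleCat.of A N)
      exact subsingleton_of_forall_eq 0 fun x => by
        rw [← Ext.mk₀_id_comp x, h0.eq_of_src (𝟙 _) 0, Ext.mk₀_zero, Ext.zero_comp]
    exact induction_on_quotient_prime_of_support_subset (R := A) Set.univ
      (motive := fun N i₁ i₂ _ => Subsingleton (Ext.{0} (@ModuleCat.of A _ N i₁ i₂)
        (ModuleCat.of A A) i)) (fun N _ _ _ _ => hsub N)
      (fun p _ => by rwa [hA p.asIdeal p.2])
      (fun N₁ _ _ _ N₂ _ _ _ N₃ _ _ _ f g _ hf hg hfg h₁ h₃ =>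
        subsingleton_ext_left_of_exact _ hf hg hfg i h₁ h₃) N
      (Set.subset_univ _)

theorem exists_linearMap_apply_ne_zero (hA : ∀ P : Ideal A, P.IsPrime → P = maximalIdeal A)
    (hExt : ∀ (N : Type) [AddCommGroup N] [Module A N] [Module.Finite A N],
      Subsingleton (Ext.{0} (ModuleCat.of A N) (ModuleCat.of A A) 1))
    {M : Type} [AddCommGroup M] [Module A M] [Module.Finite A M] {c : M} (hc : c ≠ 0) :
    ∃ f : M →ₗ[A] A, f c ≠ 0 := by
  obtain ⟨ι, hι⟩ := exists_injective_linearMap_quotient_maximalIdeal hA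
  let τ := LinearMap.toSpanSingleton A M c
  have hτ : LinearMap.ker τ ≤ maximalIdeal A := by
    refine le_maximalIdeal fun h => hc ?_
    rw [LinearMap.ker_eq_top] at h
    simpa [τ] using LinearMap.congr_fun h 1
  let φ : LinearMap.range τ →ₗ[A] A :=
    ι ∘ₗ Submodule.factor hτ ∘ₗ τ.quotKerEquivRange.symm.toLinearMap
  obtain ⟨f, hf⟩ := exists_extension_of_subsingleton_ext_one
    (Submodule.injective_subtype (LinearMap.range τ)) (Submodule.mkQ_surjective _)
    (LinearMap.exact_subtype_mkQ _) (hExt _) φ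
  refine ⟨f, ?_⟩
  have h1 : f c = φ (τ.quotKerEquivRange (Submodule.Quotient.mk 1)) := by
    have hc1 : (τ.quotKerEquivRange (Submodule.Quotient.mk 1) : M) = c := by
      rw [LinearMap.quotKerEquivRange_apply_mk]
      exact one_smul A c
    rw [← hf, LinearMap.comp_apply, Submodule.subtype_apply, hc1]
  rw [h1]
  simp only [φ, LinearMap.comp_apply, LinearEquiv.coe_coe, LinearEquiv.symm_apply_apply]
  rw [ne_eq, LinearMap.map_eq_zero_iff _ hι]
  intro h
  exact (Ideal.ne_top_iff_one _).1 (maximalIdeal.isMaximal A).ne_top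
    ((Submodule.Quotient.mk_eq_zero _).1 h)

/-- Over a zero-dimensional Gorenstein local ring, a finite module whose endomorphisms are all
homotheties and which is faithful is free of rank one. -/
theorem nonempty_linearEquiv_of_homothety_bijective
    (hA : ∀ P : Ideal A, P.IsPrime → P = maximalIdeal A)
    (hExt : ∀ (N : Type) [AddCommGroup N] [Module A N] [Module.Finite A N],
      Subsingleton (Ext.{0} (ModuleCat.of A N) (ModuleCat.of A A) 1))
    {M : Type} [AddCommGroup M] [Module A M] [Module.Finite A M]
    (hM : Function.Bijective (algebraMap A (Module.End A M))) : Nonempty (M ≃ₗ[A] A) := by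
  obtain ⟨ι, hι⟩ := exists_injective_linearMap_quotient_maximalIdeal hA
  have hunit : ∃ (f : M →ₗ[A] A) (c : M), IsUnit (f c) := by
    by_contra! h
    set s := ι (Submodule.Quotient.mk 1) with hs
    have hs0 : ∀ x ∈ maximalIdeal A, s * x = 0 := by
      intro x hx
      rw [mul_comm, ← smul_eq_mul, hs, ← map_smul, ← Submodule.Quotient.mk_smul, smul_eq_mul,
        mul_one, (Submodule.Quotient.mk_eq_zero _).2 hx, map_zero]
    have hsM : ∀ c : M, s • c = 0 := by
      intro c
      by_contra hc
      obtain ⟨f, hf⟩ := exists_linearMap_apply_ne_zero hA hExt hc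
      exact hf (by rw [map_smul, smul_eq_mul, hs0 _ ((mem_maximalIdeal _).2 (h f c))])
    have hs1 : s = 0 := hM.1 (by ext c; simp [hsM])
    rw [hs, LinearMap.map_eq_zero_iff _ hι] at hs1
    exact (Ideal.ne_top_iff_one _).1 (maximalIdeal.isMaximal A).ne_top
      ((Submodule.Quotient.mk_eq_zero _).1 hs1)
  obtain ⟨f, c, u, hu⟩ := hunit
  obtain ⟨a, ha⟩ := hM.2 ((LinearMap.toSpanSingleton A M c) ∘ₗ f)
  have ha' : ∀ x, a • x = f x • c := fun x => by simpa using LinearMap.congr_fun ha x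
  have hau : a = u := by
    have := congrArg f (ha' c)
    rw [map_smul, map_smul, ← hu, smul_eq_mul, smul_eq_mul] at this
    exact u.isUnit.mul_right_cancel this
  refine ⟨LinearEquiv.ofBijective f ⟨fun x y hxy => ?_, fun b => ⟨((↑u⁻¹ : A) * b) • c, ?_⟩⟩⟩
  · have : a • x = a • y := by rw [ha', ha', hxy]
    rw [hau] at this
    exact u.isUnit.smul_left_cancel.1 this
  · rw [map_smul, ← hu, smul_eq_mul, mul_comm, ← mul_assoc, u.mul_inv, one_mul]

end Artinian

section LocalizedHomothety

variable {R : Type u} [CommRing R]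

theorem homothety_bijective_localizedModule [IsNoetherianRing R] (S : Submonoid R) {M : Type*}
    [AddCommGroup M] [Module R M] [Module.Finite R M]
    (hM : Function.Bijective (algebraMap R (Module.End R M))) :
    Function.Bijective
      (algebraMap (Localization S) (Module.End (Localization S) (LocalizedModule S M))) := by
  have hfp : Module.FinitePresentation R M := Module.finitePresentation_of_finite R M
  let ℓ := LocalizedModule.mkLinearMap S M
  constructor
  · rw [injective_iff_map_eq_zero]
    intro x hx
    induction x using Localization.induction_on with
    | H y =>
      obtain ⟨r, s⟩ := y
      have h0 : ∀ m : M, LocalizedModule.mk (r • m) s = 0 := fun m => by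
        have := LinearMap.congr_fun hx (LocalizedModule.mk m 1)
        rwa [Module.algebraMap_end_apply, LocalizedModule.mk_smul_mk, mul_one] at this
      have h1 : ℓ.comp (algebraMap R (Module.End R M) r) = ℓ.comp (0 : M →ₗ[R] M) := by
        ext m
        have := congrArg (s.1 • ·) (h0 m)
        rw [LocalizedModule.smul'_mk, smul_zero, ← Submonoid.smul_def,
          LocalizedModule.mk_cancel] at this
        exact this.trans (map_zero ℓ).symm
      obtain ⟨t, ht⟩ := Module.Finite.exists_smul_of_comp_eq_of_isLocalizedModule S ℓ _ _ h1
      have : t.1 * r = 0 := hM.1 (by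
        rw [map_mul, map_zero]
        ext m
        have := LinearMap.congr_fun ht m
        simp only [LinearMap.smul_apply, smul_zero, Module.algebraMap_end_apply,
          LinearMap.zero_apply] at this
        exact this)
      rw [Localization.mk_eq_mk', IsLocalization.mk'_eq_zero_iff]
      exact ⟨t, this⟩
  · intro φ
    obtain ⟨h, s, hs⟩ := Module.FinitePresentation.exists_lift_of_isLocalizedModule S ℓ
      ((φ.restrictScalars R).comp ℓ)
    obtain ⟨a, rfl⟩ := hM.2 h
    refine ⟨Localization.mk a s, ?_⟩
    ext x
    induction x using LocalizedModule.induction_on with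
    | h m t =>
      have h1 : LocalizedModule.mk (a • m) 1 = s.1 • φ (LocalizedModule.mk m 1) :=
        LinearMap.congr_fun hs m
      have h2 : φ (LocalizedModule.mk m 1) = LocalizedModule.mk (a • m) s := by
        rw [← one_smul (Localization S) (φ _), ← Localization.mk_self s, ← mul_one s.1,
          ← smul_eq_mul, ← Localization.smul_mk, smul_assoc, smul_comm, ← h1,
          LocalizedModule.mk_smul_mk, one_smul, mul_one]
      have h3 : LocalizedModule.mk m t =
          Localization.mk (1 : R) t • LocalizedModule.mk m (1 : S) := by
        rw [LocalizedModule.mk_smul_mk, one_smul, mul_one]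
      rw [Module.algebraMap_end_apply, h3, map_smul, h2, LocalizedModule.mk_smul_mk,
        LocalizedModule.mk_smul_mk, one_smul, LocalizedModule.mk_smul_mk, one_smul, mul_one,
        mul_comm]

end LocalizedHomothety

section Gorenstein

open IsLocalRing

variable {R : Type} [CommRing R] [IsNoetherianRing R]

theorem localLength_eq_of_homothety_bijective {p : PrimeSpectrum R}
    (hp : p.asIdeal ∈ minimalPrimes R)
    (hG : HasFiniteInjectiveDimension (Localization.AtPrime p.asIdeal)
      (Localization.AtPrime p.asIdeal)) {M : Type} [AddCommGroup M] [Module R M] [Module.Finite R M]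
    (hM : Function.Bijective (algebraMap R (Module.End R M))) :
    localLength p M = Module.length (Localization.AtPrime p.asIdeal)
      (Localization.AtPrime p.asIdeal) := by
  have hN : IsNoetherianRing (Localization.AtPrime p.asIdeal) :=
    IsLocalization.isNoetherianRing p.asIdeal.primeCompl _ inferInstance
  have hA : ∀ P : Ideal (Localization.AtPrime p.asIdeal), P.IsPrime →
      P = maximalIdeal (Localization.AtPrime p.asIdeal) := fun P hP => by
    have := IsLocalization.subsingleton_primeSpectrum_of_mem_minimalPrimes p.asIdeal hp
      (Localization.AtPrime p.asIdeal)
    exact congrArg PrimeSpectrum.asIdeal (Subsingleton.elim (α := PrimeSpectrum _) ⟨P, hP⟩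
      (closedPoint (Localization.AtPrime p.asIdeal)))
  obtain ⟨n, hn⟩ := hG
  obtain ⟨e⟩ := nonempty_linearEquiv_of_homothety_bijective hA
    (fun N _ _ _ => subsingleton_ext_of_eventually hA (n := n)
      (fun N i hi => (subsingleton_extModule_iff _ _ _ (by lia)).1 (hn N i hi)) N one_pos)
    (homothety_bijective_localizedModule p.asIdeal.primeCompl hM)
  exact e.length_eq

end Gorenstein

section QuotientRing

variable {R : Type*} [CommRing R] {I : Ideal R} {M : Type*} [AddCommGroup M] [Module R M]

theorem Module.support_subset_zeroLocus_of_quotient [Module (R ⧸ I) M] [IsScalarTower R (R ⧸ I) M] :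
    Module.support R M ⊆ PrimeSpectrum.zeroLocus (I : Set R) := by
  intro p hp x hx
  obtain ⟨m, hm⟩ := Module.mem_support_iff_exists_annihilator.1 hp
  refine hm ((Submodule.mem_annihilator_span_singleton _ _).2 ?_)
  rw [← algebraMap_smul (R ⧸ I), Ideal.Quotient.algebraMap_eq, Ideal.Quotient.eq_zero_iff_mem.2 hx,
    zero_smul]

theorem length_quotient_pow_smul_eq_comap [Module (R ⧸ I) M] [IsScalarTower R (R ⧸ I) M]
    (J : Ideal (R ⧸ I)) (n : ℕ) :
    Module.length (R ⧸ I) (M ⧸ (J ^ n • (⊤ : Submodule (R ⧸ I) M))) =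
      Module.length R (M ⧸ ((J.comap (Ideal.Quotient.mk I)) ^ n • (⊤ : Submodule R M))) := by
  have hJ : J ^ n = ((J.comap (Ideal.Quotient.mk I)) ^ n).map (algebraMap R (R ⧸ I)) := by
    rw [Ideal.map_pow, Ideal.Quotient.algebraMap_eq,
      Ideal.map_comap_of_surjective _ Ideal.Quotient.mk_surjective]
  have h := Ideal.smul_restrictScalars ((J.comap (Ideal.Quotient.mk I)) ^ n)
    (⊤ : Submodule (R ⧸ I) M)
  rw [← hJ, Submodule.restrictScalars_top] at h
  rw [← h, ((Submodule.Quotient.restrictScalarsEquiv R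
      (J ^ n • (⊤ : Submodule (R ⧸ I) M)))).length_eq]
  exact (Module.length_eq_of_surjective Ideal.Quotient.mk_surjective).symm

end QuotientRing

theorem moduleLength_eq_toNat {R M : Type} [CommRing R] [AddCommGroup M] [Module R M] {k : ℕ∞}
    (h : Module.length R M = k) (hk : k ≠ ⊤) : moduleLength R M = (k.toNat : WithBot ℕ∞) := by
  rw [moduleLength, ← Module.coe_length, h]
  lift k to ℕ using hk
  rfl

/-- multiplicities of semidualizing modules along quotients by regular
sequences, for equidimensional local rings with Gorenstein formal fibres at minimal primes. -/
theorem statement1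
    (R : Type) [CommRing R] [IsLocalRing R] [IsNoetherianRing R]
    (hequi : ∀ p ∈ minimalPrimes R, ringKrullDim (R ⧸ p) = ringKrullDim R)
    (hGor : ∀ (p : Ideal R) [p.IsPrime], p ∈ minimalPrimes R →
      IsGorensteinLocalRing (Localization.AtPrime p) ∧
      ∀ (q : Ideal (TensorProduct R (IsLocalRing.ResidueField (Localization.AtPrime p))
          (AdicCompletion (IsLocalRing.maximalIdeal R) R))) [q.IsPrime],
        IsGorensteinLocalRing (Localization.AtPrime q))
    (ys : List R) (hys : ∀ y ∈ ys, y ∈ IsLocalRing.maximalIdeal R)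
    (hreg : RingTheory.Sequence.IsRegular R ys)
    (C : Type) [AddCommGroup C] [Module R C] (hC : IsSemidualizing R C)
    (d' : ℕ) (hd' : ringKrullDim (R ⧸ Ideal.ofList ys) = d')
    (J : Ideal (R ⧸ Ideal.ofList ys))
    (hJ : J.radical =
      Ideal.map (Ideal.Quotient.mk (Ideal.ofList ys)) (IsLocalRing.maximalIdeal R)) :
    ∃ p : Polynomial ℚ, p.degree < (d' : WithBot ℕ) ∧
      ∀ᶠ n : ℕ in Filter.atTop, ∃ a b : ℕ,
        moduleLength (R ⧸ Ideal.ofList ys)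
          ((TensorProduct R (R ⧸ Ideal.ofList ys) C) ⧸
            (J ^ n • (⊤ : Submodule (R ⧸ Ideal.ofList ys)
              (TensorProduct R (R ⧸ Ideal.ofList ys) C)))) = (a : WithBot ℕ∞) ∧
        moduleLength (R ⧸ Ideal.ofList ys) ((R ⧸ Ideal.ofList ys) ⧸ (J ^ n)) =
          (b : WithBot ℕ∞) ∧
        (a : ℚ) - (b : ℚ) = p.eval (n : ℚ) := by
  obtain ⟨hfin, hhom, hext⟩ := hC
  let J' := J.comap (Ideal.Quotient.mk (Ideal.ofList ys))
  have hJ' : ∀ p : PrimeSpectrum R, J' ≤ p.asIdeal → p.asIdeal.IsMaximal := by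
    intro p hp
    have hm : IsLocalRing.maximalIdeal R ≤ p.asIdeal := by
      intro x hx
      obtain ⟨k, hk⟩ : Ideal.Quotient.mk (Ideal.ofList ys) x ∈ J.radical :=
        hJ ▸ Ideal.mem_map_of_mem _ hx
      exact p.2.mem_of_pow_mem k (hp (by rwa [Ideal.mem_comap, map_pow]))
    rw [← (IsLocalRing.maximalIdeal.isMaximal R).eq_of_le p.2.ne_top hm]
    infer_instance
  have hann : Module.annihilator R C = ⊥ := by
    rw [eq_bot_iff]
    intro x hx
    refine hhom.1 ?_
    rw [map_zero]
    ext c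
    exact Module.mem_annihilator.1 hx c
  have hCreg : RingTheory.Sequence.IsWeaklyRegular C ys :=
    isWeaklyRegular_of_linearMap hann
      (fun i hi => (subsingleton_extModule_iff _ _ _ hi).1 (hext i hi))
      (((LinearEquiv.ofBijective (Algebra.linearMap R (Module.End R C))
        hhom).isWeaklyRegular_congr ys).1 hreg.toIsWeaklyRegular)
  have hRbij : Function.Bijective (algebraMap R (Module.End R R)) := by
    refine ⟨fun a b hab => ?_, fun f => ⟨f 1, ?_⟩⟩
    · simpa using LinearMap.congr_fun hab 1
    · ext
      simp
  have hlen : ∀ p : PrimeSpectrum R, p.asIdeal ∈ minimalPrimes R →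
      localLength p C = localLength p R := fun p hp => by
    have hG := (hGor p.asIdeal hp).1.2.2
    rw [localLength_eq_of_homothety_bijective hp hG hhom,
      localLength_eq_of_homothety_bijective hp hG hRbij]
  have hloc : ∀ P : PrimeSpectrum R, P.asIdeal ∈ (Ideal.ofList ys).minimalPrimes →
      localLength P (TensorProduct R (R ⧸ Ideal.ofList ys) C) =
        localLength P (R ⧸ Ideal.ofList ys) := fun P hP => by
    rw [localLength_eq_of_linearEquiv P (TensorProduct.quotTensorEquivQuotSMul C (Ideal.ofList ys)),
      localLength_quotient_ofList_eq hP hCreg hreg.toIsWeaklyRegular hlen]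
    exact localLength_eq_of_linearEquiv P (Submodule.quotEquivOfEq _ _ (by simp))
  refine ⟨hilbertSamuelPoly J' (TensorProduct R (R ⧸ Ideal.ofList ys) C) -
      hilbertSamuelPoly J' (R ⧸ Ideal.ofList ys),
    degree_hilbertSamuelPoly_sub_lt hJ' hd'.le Module.support_subset_zeroLocus_of_quotient
      Module.support_subset_zeroLocus_of_quotient hloc, ?_⟩
  filter_upwards [hilbertSamuel_eventually_eq hJ' (TensorProduct R (R ⧸ Ideal.ofList ys) C),
    hilbertSamuel_eventually_eq hJ' (R ⧸ Ideal.ofList ys)] with n h₁ h₂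
  refine ⟨_, _, moduleLength_eq_toNat (length_quotient_pow_smul_eq_comap J n)
    (length_quotient_pow_smul_ne_top hJ' _ n), moduleLength_eq_toNat (Eq.trans ?_
      (length_quotient_pow_smul_eq_comap J n))
      (length_quotient_pow_smul_ne_top hJ' (R ⧸ Ideal.ofList ys) n), ?_⟩
  · exact (Submodule.quotEquivOfEq _ _ (by simp)).length_eq
  · rw [Polynomial.eval_sub, ← h₁, ← h₂]
    rfl
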